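/- Let n ≥ 2, let Ω ⊂ ℝ^n be a bounded domain, let H satisfy Conditions A and B with homogeneity exponent k = k₁ + 1, and let λ > 0. Suppose u is upper semicontinuous on cl(Ω) with u > 0 on cl(Ω) and is a viscosity subsolution of H(Du, D²u) + λ u^k = 0 in Ω (i.e. H(Du,D²u) + λu^k ≥ 0 in the viscosity sense), and v is lower semicontinuous on cl(Ω) with v > 0 on cl(Ω) and is a viscosity supersolution of H(Dv, D²v) + λ v^k = 0 in Ω (i.e. H(Dv,D²v) + λv^k ≤ 0 in the viscosity sense). Then u/v ≤ sup_{∂Ω} (u/v) in Ω. -/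

import Mathlib

open Set Filter Metric

noncomputable section

namespace DNLP

/-- Euclidean space ℝⁿ. -/
abbrev En (n : ℕ) := EuclideanSpace ℝ (Fin n)

/-- n×n real matrices (we use these for the symmetric matrices Sⁿ). -/
abbrev Sym (n : ℕ) := Matrix (Fin n) (Fin n) ℝ

variable {n : ℕ}

/-- Loewner order: X ≤ Y iff Y − X is positive semidefinite. -/
def LoewnerLE (X Y : Sym n) : Prop := (Y - X).PosSemidef

/-- Rank-one matrix p ⊗ q with entries pᵢ qⱼ. -/
def vouter (p q : En n) : Sym n := Matrix.of fun i j => p i * q j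

/-- Spatial gradient of ψ(·,t) at y. -/
def sgrad (ψ : En n → ℝ → ℝ) (y : En n) (t : ℝ) : En n :=
  gradient (fun x => ψ x t) y

/-- Spatial Hessian matrix of ψ(·,t) at y. -/
def shess (ψ : En n → ℝ → ℝ) (y : En n) (t : ℝ) : Sym n :=
  Matrix.of fun i j =>
    fderiv ℝ (fun x => fderiv ℝ (fun x' => ψ x' t) x (EuclideanSpace.single j (1:ℝ))) y
      (EuclideanSpace.single i (1:ℝ))

/-- Time derivative ψ_t at (y,t). -/
def tpartial (ψ : En n → ℝ → ℝ) (y : En n) (t : ℝ) : ℝ := deriv (fun s => ψ y s) t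

/-- Test functions: C² in x and C¹ in t. -/
def IsTestFn (ψ : En n → ℝ → ℝ) : Prop :=
  (∀ t, ContDiff ℝ 2 fun x => ψ x t) ∧ (∀ x, ContDiff ℝ 1 fun s => ψ x s)

/-- Condition A: continuity, H(p,0)=0 and degenerate ellipticity (monotonicity). -/
def CondA (H : En n → Sym n → ℝ) : Prop :=
  Continuous (fun q : En n × Sym n => H q.1 q.2) ∧
  (∀ p, H p 0 = 0) ∧
  ∀ (p : En n) (X Y : Sym n), LoewnerLE X Y → H p X ≤ H p Y

/-- Condition B: homogeneity of degree k₁ in the gradient and degree 1 in the Hessian. -/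
def CondB (H : En n → Sym n → ℝ) (k₁ : ℝ) : Prop :=
  0 ≤ k₁ ∧
  (∀ (θ : ℝ) (p : En n) (X : Sym n), H (θ • p) X = |θ| ^ k₁ * H p X) ∧
  ∀ (θ : ℝ), 0 < θ → ∀ (p : En n) (X : Sym n), H p (θ • X) = θ * H p X

/-- Condition C (coercivity): m(Λ) > 0 for Λ < 1 and M(Λ) < 0 for Λ ≥ Λ₁, expressed
pointwise over unit vectors (equivalent by compactness of the sphere and continuity). -/
def CondC (H : En n → Sym n → ℝ) : Prop :=
  (∀ Λ : ℝ, Λ < 1 → ∀ e : En n, ‖e‖ = 1 →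
      0 < H e (1 - Λ • vouter e e) ∧ H e (Λ • vouter e e - 1) < 0) ∧
  ∃ Λ₁ : ℝ, 1 ≤ Λ₁ ∧ ∀ Λ : ℝ, Λ₁ ≤ Λ → ∀ e : En n, ‖e‖ = 1 →
      H e (1 - Λ • vouter e e) < 0 ∧ 0 < H e (Λ • vouter e e - 1)

/-- Viscosity supersolution of H(Du,D²u) − u^{k−1} u_t = 0 on the set Q (Γ_k[u] ≤ 0). -/
def ParSuper (H : En n → Sym n → ℝ) (k : ℝ) (Q : Set (En n × ℝ)) (u : En n → ℝ → ℝ) : Prop :=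
  ∀ ψ : En n → ℝ → ℝ, IsTestFn ψ → ∀ y t, (y, t) ∈ Q →
    IsLocalMinOn (fun p : En n × ℝ => u p.1 p.2 - ψ p.1 p.2) Q (y, t) →
    H (sgrad ψ y t) (shess ψ y t) - u y t ^ (k - 1) * tpartial ψ y t ≤ 0

/-- Viscosity subsolution of H(Du,D²u) − u^{k−1} u_t = 0 on the set Q (Γ_k[u] ≥ 0). -/
def ParSub (H : En n → Sym n → ℝ) (k : ℝ) (Q : Set (En n × ℝ)) (u : En n → ℝ → ℝ) : Prop :=
  ∀ ψ : En n → ℝ → ℝ, IsTestFn ψ → ∀ y t, (y, t) ∈ Q →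
    IsLocalMaxOn (fun p : En n × ℝ => u p.1 p.2 - ψ p.1 p.2) Q (y, t) →
    0 ≤ H (sgrad ψ y t) (shess ψ y t) - u y t ^ (k - 1) * tpartial ψ y t

/-- The parabolic cylinder Ω_T = Ω × (0,T). -/
def pcyl (Ω : Set (En n)) (T : ℝ) : Set (En n × ℝ) := Ω ×ˢ Ioo 0 T

/-- The parabolic boundary P_T = (cl(Ω) × {0}) ∪ (∂Ω × [0,T)). -/
def pbdry (Ω : Set (En n)) (T : ℝ) : Set (En n × ℝ) :=
  (closure Ω ×ˢ ({0} : Set ℝ)) ∪ (frontier Ω ×ˢ Ico 0 T)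

/-- Ω_∞ = Ω × (0,∞). -/
def pcylInf (Ω : Set (En n)) : Set (En n × ℝ) := Ω ×ˢ Ioi 0

/-- P_∞ = (cl(Ω) × {0}) ∪ (∂Ω × [0,∞)). -/
def pbdryInf (Ω : Set (En n)) : Set (En n × ℝ) :=
  (closure Ω ×ˢ ({0} : Set ℝ)) ∪ (frontier Ω ×ˢ Ici 0)

/-- Viscosity subsolution of F(t,Du,D²u + Du⊗Du) − f(t) u_t = 0 on Q. -/
def ParSubF (F : ℝ → En n → Sym n → ℝ) (f : ℝ → ℝ) (Q : Set (En n × ℝ))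
    (u : En n → ℝ → ℝ) : Prop :=
  ∀ ψ : En n → ℝ → ℝ, IsTestFn ψ → ∀ y t, (y, t) ∈ Q →
    IsLocalMaxOn (fun p : En n × ℝ => u p.1 p.2 - ψ p.1 p.2) Q (y, t) →
    0 ≤ F t (sgrad ψ y t) (shess ψ y t + vouter (sgrad ψ y t) (sgrad ψ y t))
        - f t * tpartial ψ y t

/-- Viscosity supersolution of F(t,Du,D²u + Du⊗Du) − f(t) u_t = 0 on Q. -/
def ParSuperF (F : ℝ → En n → Sym n → ℝ) (f : ℝ → ℝ) (Q : Set (En n × ℝ))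
    (u : En n → ℝ → ℝ) : Prop :=
  ∀ ψ : En n → ℝ → ℝ, IsTestFn ψ → ∀ y t, (y, t) ∈ Q →
    IsLocalMinOn (fun p : En n × ℝ => u p.1 p.2 - ψ p.1 p.2) Q (y, t) →
    F t (sgrad ψ y t) (shess ψ y t + vouter (sgrad ψ y t) (sgrad ψ y t))
        - f t * tpartial ψ y t ≤ 0

/-- Viscosity subsolution of H(Dw, D²w + Dw⊗Dw) − w_t = 0 on Q. -/
def ParSubLog (H : En n → Sym n → ℝ) (Q : Set (En n × ℝ)) (w : En n → ℝ → ℝ) : Prop :=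
  ParSubF (fun _ p X => H p X) (fun _ => 1) Q w

/-- Viscosity supersolution of H(Dw, D²w + Dw⊗Dw) − w_t = 0 on Q. -/
def ParSuperLog (H : En n → Sym n → ℝ) (Q : Set (En n × ℝ)) (w : En n → ℝ → ℝ) : Prop :=
  ParSuperF (fun _ p X => H p X) (fun _ => 1) Q w

/-- Hessian matrix of φ : ℝⁿ → ℝ at y. -/
def ehess (φ : En n → ℝ) (y : En n) : Sym n :=
  Matrix.of fun i j =>
    fderiv ℝ (fun x => fderiv ℝ φ x (EuclideanSpace.single j (1:ℝ))) y
      (EuclideanSpace.single i (1:ℝ))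

/-- Elliptic viscosity condition H(Du,D²u) ≥ f in Ω (subsolution). -/
def EllSub (H : En n → Sym n → ℝ) (Ω : Set (En n)) (u : En n → ℝ) (f : En n → ℝ) : Prop :=
  ∀ φ : En n → ℝ, ContDiff ℝ 2 φ → ∀ y ∈ Ω,
    IsLocalMaxOn (fun x => u x - φ x) Ω y →
    f y ≤ H (gradient φ y) (ehess φ y)

/-- Elliptic viscosity condition H(Dv,D²v) ≤ f in Ω (supersolution). -/
def EllSuper (H : En n → Sym n → ℝ) (Ω : Set (En n)) (v : En n → ℝ) (f : En n → ℝ) : Prop :=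
  ∀ φ : En n → ℝ, ContDiff ℝ 2 φ → ∀ y ∈ Ω,
    IsLocalMinOn (fun x => v x - φ x) Ω y →
    H (gradient φ y) (ehess φ y) ≤ f y

/-- Uniform outer ball condition. -/
def UnifOuterBall (Ω : Set (En n)) : Prop :=
  ∃ ρ₀ : ℝ, 0 < ρ₀ ∧ ∀ y ∈ frontier Ω, ∃ q : En n,
    q ∉ Ω ∧ Metric.ball q ρ₀ ⊆ Ωᶜ ∧ y ∈ Metric.sphere q ρ₀

/-- Outer ball condition (radius may vary with the boundary point). -/
def OuterBallCond (Ω : Set (En n)) : Prop :=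
  ∀ y ∈ frontier Ω, ∃ ρ : ℝ, 0 < ρ ∧ ∃ q : En n,
    q ∉ Ω ∧ Metric.ball q ρ ⊆ Ωᶜ ∧ y ∈ Metric.sphere q ρ

section Jensen
open Topology MeasureTheory
variable {E : Type*} [NormedAddCommGroup E] [InnerProductSpace ℝ E]

local notation "⟪" x "," y "⟫" => inner ℝ x y

/-- A real function whose increments on `[0, 1]` are linear up to a quadratic error has total
increment controlled by the linear rate. -/
theorem sub_le_of_increment_le {ψ : ℝ → ℝ} {a K : ℝ}
    (h : ∀ s t, 0 ≤ s → s ≤ t → t ≤ 1 → ψ t - ψ s ≤ a * (t - s) + K * (t - s) ^ 2) :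
    ψ 1 - ψ 0 ≤ a := by
  have key : ∀ m : ℕ, ψ 1 - ψ 0 ≤ a + K * (1 / ((m : ℝ) + 1)) := by
    intro m
    have hm : (0 : ℝ) < (m : ℝ) + 1 := by positivity
    have ind : ∀ i : ℕ, i ≤ m + 1 →
        ψ (i / ((m : ℝ) + 1)) - ψ 0 ≤ i * (a / (m + 1) + K * (1 / ((m : ℝ) + 1)) ^ 2) := by
      intro i
      induction i with
      | zero => intro _; simp
      | succ i ih =>
        intro hi
        have h1 := ih (by omega)
        have h2 := h (i / ((m : ℝ) + 1)) ((i + 1 : ℕ) / ((m : ℝ) + 1)) (by positivity)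
          (by gcongr; simp) (by
            rw [div_le_one hm]; exact_mod_cast hi)
        have e : ((i + 1 : ℕ) / ((m : ℝ) + 1)) - (i / ((m : ℝ) + 1)) = 1 / ((m : ℝ) + 1) := by
          push_cast; ring
        rw [e] at h2
        have e2 : a / ((m : ℝ) + 1) = a * (1 / ((m : ℝ) + 1)) := by ring
        rw [e2] at h1 ⊢
        push_cast at h2 ⊢
        linarith
    have h3 := ind (m + 1) le_rfl
    have e1 : (((m + 1 : ℕ) : ℝ) / ((m : ℝ) + 1)) = 1 := by push_cast; field_simp
    rw [e1] at h3
    have e2 : (((m + 1 : ℕ) : ℝ)) * (a / (m + 1) + K * (1 / ((m : ℝ) + 1)) ^ 2)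
        = a + K * (1 / ((m : ℝ) + 1)) := by push_cast; field_simp
    rwa [e2] at h3
  have lim : Tendsto (fun m : ℕ => a + K * (1 / ((m : ℝ) + 1))) atTop (𝓝 (a + K * 0)) :=
    (tendsto_one_div_add_atTop_nhds_zero_nat.const_mul K).const_add a
  simpa using ge_of_tendsto' lim key

/-- `g` has at every point a supporting paraboloid of opening `m`. -/
def HasParaboloidSupport (m : ℝ) (g : E → ℝ) : Prop :=
  ∀ z, ∃ q : E, ∀ w, g z + ⟪q, w - z⟫ + m / 2 * ‖w - z‖ ^ 2 ≤ g w

theorem HasParaboloidSupport.add_norm_sq {m : ℝ} {g : E → ℝ} (hg : HasParaboloidSupport m g)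
    (c : ℝ) : HasParaboloidSupport (m + 2 * c) (fun z => g z + c * ‖z‖ ^ 2) := by
  intro z
  obtain ⟨q, hq⟩ := hg z
  refine ⟨q + (2 * c) • z, fun w => ?_⟩
  have h := hq w
  have e : ‖w‖ ^ 2 = ‖z‖ ^ 2 + 2 * ⟪z, w - z⟫ + ‖w - z‖ ^ 2 := by
    rw [← norm_add_sq_real]; simp
  simp only [inner_add_left, real_inner_smul_left]
  rw [e]
  linarith

theorem HasParaboloidSupport.convexOn {g : E → ℝ} (hg : HasParaboloidSupport 0 g) :
    ConvexOn ℝ univ g := by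
  refine ⟨convex_univ, fun x _ y _ a b ha hb hab => ?_⟩
  obtain ⟨q, hq⟩ := hg (a • x + b • y)
  have h1 := mul_le_mul_of_nonneg_left (hq x) ha
  have h2 := mul_le_mul_of_nonneg_left (hq y) hb
  have e : a * ⟪q, x - (a • x + b • y)⟫ + b * ⟪q, y - (a • x + b • y)⟫ = 0 := by
    simp only [inner_sub_right, inner_add_right, real_inner_smul_right]
    linear_combination (-(a * ⟪q, x⟫ + b * ⟪q, y⟫)) * hab
  have e2 : a * g (a • x + b • y) + b * g (a • x + b • y) = g (a • x + b • y) := by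
    rw [← add_mul, hab, one_mul]
  simp only [smul_eq_mul]
  linarith

theorem HasParaboloidSupport.continuous [FiniteDimensional ℝ E] {m : ℝ} {g : E → ℝ}
    (hg : HasParaboloidSupport m g) : Continuous g := by
  have h := hg.add_norm_sq (-m / 2)
  have h0 : m + 2 * (-m / 2) = 0 := by ring
  rw [h0] at h
  have hc : Continuous fun z => g z + -m / 2 * ‖z‖ ^ 2 :=
    continuousOn_univ.1 (by simpa using h.convexOn.continuousOn_interior)
  have := hc.sub (by fun_prop : Continuous fun z : E => -m / 2 * ‖z‖ ^ 2)
  convert this using 1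
  ext z
  simp

/-- A continuous function with quadratic decay attains its maximum after tilting. -/
theorem exists_tilted_max [FiniteDimensional ℝ E] {f : E → ℝ} (hf : Continuous f) {C c : ℝ}
    (hc : 0 < c) (hco : ∀ w, f w ≤ C - c * ‖w‖ ^ 2) (p : E) :
    ∃ z, ∀ w, f w ≤ f z + ⟪p, w - z⟫ := by
  have hcont : Continuous fun w => f w - ⟪p, w⟫ := by fun_prop
  have hlim : Tendsto (fun w => f w - ⟪p, w⟫) (cocompact E) atBot := by
    have hn : Tendsto (fun w : E => ‖w‖) (cocompact E) atTop := tendsto_norm_cocompact_atTop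
    have h1 : Tendsto (fun t : ℝ => C + ‖p‖ ^ 2 / (2 * c) - c / 2 * t ^ 2) atTop atBot := by
      have : Tendsto (fun t : ℝ => c / 2 * t ^ 2) atTop atTop :=
        (tendsto_pow_atTop two_ne_zero).const_mul_atTop (by positivity)
      exact tendsto_atBot_add_const_left _ _ (tendsto_neg_atTop_atBot.comp this)
    refine tendsto_atBot_mono (fun w => ?_) (h1.comp hn)
    have h2 := hco w
    have h3 : -⟪p, w⟫ ≤ ‖p‖ * ‖w‖ := by
      have := abs_real_inner_le_norm p w
      exact (neg_le_abs _).trans this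
    have h4 : ‖p‖ * ‖w‖ ≤ ‖p‖ ^ 2 / (2 * c) + c / 2 * ‖w‖ ^ 2 := by
      have : ‖p‖ ^ 2 / (2 * c) + c / 2 * ‖w‖ ^ 2 - ‖p‖ * ‖w‖
        = (‖p‖ - c * ‖w‖) ^ 2 / (2 * c) := by field_simp; ring
      have : 0 ≤ (‖p‖ - c * ‖w‖) ^ 2 / (2 * c) := by positivity
      linarith
    simp only [Function.comp]
    linarith
  obtain ⟨z, hz⟩ := hcont.exists_forall_ge hlim
  refine ⟨z, fun w => ?_⟩
  have := hz w
  rw [inner_sub_right]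
  linarith

/-- Around a minimum of `g - ⟪q, ·⟫`, a function with supporting paraboloids grows quadratically. -/
theorem HasParaboloidSupport.growth_of_min {m : ℝ} {g : E → ℝ} (hg : HasParaboloidSupport m g)
    {q z : E} (hz : ∀ w, g z + ⟪q, w - z⟫ ≤ g w) (w : E) :
    g z + ⟪q, w - z⟫ + m / 4 * ‖w - z‖ ^ 2 ≤ g w := by
  set y := z + (2⁻¹ : ℝ) • (w - z) with hy
  obtain ⟨r, hr⟩ := hg y
  have h1 := hr z
  have h2 := hr w
  have h3 := hz y
  have e1 : z - y = -((2⁻¹ : ℝ) • (w - z)) := by rw [hy]; abel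
  have e2 : w - y = (2⁻¹ : ℝ) • (w - z) := by rw [hy]; module
  have e3 : y - z = (2⁻¹ : ℝ) • (w - z) := by rw [hy]; abel
  rw [e1, inner_neg_right, norm_neg] at h1
  rw [e2] at h2
  rw [e3] at h3
  simp only [real_inner_smul_right, norm_smul, norm_inv, Real.norm_ofNat] at h1 h2 h3
  rw [mul_pow] at h1 h2
  linarith

theorem HasParaboloidSupport.norm_sub_le_of_min {m : ℝ} (hm : 0 < m) {g : E → ℝ}
    (hg : HasParaboloidSupport m g) {q z q' z' : E} (hz : ∀ w, g z + ⟪q, w - z⟫ ≤ g w)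
    (hz' : ∀ w, g z' + ⟪q', w - z'⟫ ≤ g w) : ‖z - z'‖ ≤ 2 / m * ‖q - q'‖ := by
  have h1 := hg.growth_of_min hz z'
  have h2 := hg.growth_of_min hz' z
  have e : ⟪q, z' - z⟫ + ⟪q', z - z'⟫ = -⟪q - q', z - z'⟫ := by
    simp only [inner_sub_left, inner_sub_right]; ring
  have h3 := real_inner_le_norm (q - q') (z - z')
  rw [norm_sub_rev z' z] at h1
  have h4 : m / 2 * ‖z - z'‖ ^ 2 ≤ ‖q - q'‖ * ‖z - z'‖ := by linarith
  rcases (norm_nonneg (z - z')).eq_or_lt with h0 | h0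
  · rw [← h0]; positivity
  · have : m / 2 * ‖z - z'‖ ≤ ‖q - q'‖ := by
      refine le_of_mul_le_mul_right ?_ h0
      linarith
    rw [div_mul_eq_mul_div, le_div_iff₀ hm]
    linarith

/-- A tangent paraboloid from above forces the gradient variable to be Lipschitz at the contact
point. -/
theorem norm_sub_le_of_touching_above {M : ℝ} (hM : 0 < M) {g : E → ℝ} {q z q' z' : E}
    (hz : ∀ w, g z + ⟪q, w - z⟫ ≤ g w) (hz' : ∀ w, g z' + ⟪q', w - z'⟫ ≤ g w)
    (hup : ∀ w, g w ≤ g z + ⟪q, w - z⟫ + M * ‖w - z‖ ^ 2) :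
    ‖q' - q‖ ≤ 4 * M * ‖z' - z‖ := by
  set y := z + (1 / (2 * M)) • (q' - q) with hy
  have h1 := hup y
  have h2 := hz' y
  have h3 := hz z'
  have e1 : y - z = (1 / (2 * M)) • (q' - q) := by rw [hy]; abel
  have e2 : y - z' = (1 / (2 * M)) • (q' - q) - (z' - z) := by rw [hy]; abel
  rw [e1] at h1
  rw [e2] at h2
  have e3 : ⟪q' - q, (1 / (2 * M)) • (q' - q)⟫ = 1 / (2 * M) * ‖q' - q‖ ^ 2 := by
    rw [real_inner_smul_right, real_inner_self_eq_norm_sq]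
  have e4 : ‖(1 / (2 * M)) • (q' - q)‖ ^ 2 = (1 / (2 * M)) ^ 2 * ‖q' - q‖ ^ 2 := by
    rw [norm_smul, mul_pow, Real.norm_eq_abs, sq_abs]
  have e5 : M * ((1 / (2 * M)) ^ 2 * ‖q' - q‖ ^ 2) = 1 / (4 * M) * ‖q' - q‖ ^ 2 := by
    field_simp; ring
  rw [e4, e5] at h1
  rw [inner_sub_right] at h2
  have h4 := real_inner_le_norm (q' - q) (z' - z)
  rw [inner_sub_left] at e3 h4
  have e6 : 1 / (2 * M) * ‖q' - q‖ ^ 2 = 2 * (1 / (4 * M) * ‖q' - q‖ ^ 2) := by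
    field_simp; ring
  have h5 : 1 / (4 * M) * ‖q' - q‖ ^ 2 ≤ ‖q' - q‖ * ‖z' - z‖ := by linarith
  rcases (norm_nonneg (q' - q)).eq_or_lt with h0 | h0
  · rw [← h0]; positivity
  · have : 1 / (4 * M) * ‖q' - q‖ ≤ ‖z' - z‖ := by
      refine le_of_mul_le_mul_right ?_ h0
      linarith
    rw [div_mul_eq_mul_div, div_le_iff₀ (by positivity)] at this
    linarith

/-- If the supporting slopes of `g` expand to first order at `z`, then `g` expands to second order
at `z`. -/
theorem second_order_of_slopes {g : E → ℝ} {z q : E} {A : E →L[ℝ] E}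
    (hA : ∀ γ > 0, ∃ r > 0, ∀ h : E, ‖h‖ < r → ∃ q', (∀ w, g (z + h) + ⟪q', w - (z + h)⟫ ≤ g w) ∧
      ‖q' - q - A h‖ ≤ γ * ‖h‖) :
    ∀ γ > 0, ∃ r > 0, ∀ h : E, ‖h‖ < r →
      |g (z + h) - g z - ⟪q, h⟫ - 1 / 2 * ⟪A h, h⟫| ≤ γ * ‖h‖ ^ 2 := by
  intro γ hγ
  obtain ⟨r, hr, H⟩ := hA γ hγ
  refine ⟨r, hr, fun h hh => ?_⟩
  set ψ : ℝ → ℝ := fun t => g (z + t • h) - t * ⟪q, h⟫ - t ^ 2 / 2 * ⟪A h, h⟫ with hψ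
  have slope : ∀ t, 0 ≤ t → t ≤ 1 → ∃ e : ℝ, |e| ≤ γ * ‖h‖ ^ 2 ∧
      ∀ s, g (z + t • h) + (s - t) * (⟪q, h⟫ + t * ⟪A h, h⟫ + e) ≤ g (z + s • h) := by
    intro t ht0 ht1
    have hth : ‖t • h‖ ≤ ‖h‖ := by
      rw [norm_smul, Real.norm_eq_abs, abs_of_nonneg ht0]
      exact mul_le_of_le_one_left (norm_nonneg _) ht1
    obtain ⟨q', hq', hq2⟩ := H (t • h) (hth.trans_lt hh)
    refine ⟨⟪q' - q - A (t • h), h⟫, ?_, fun s => ?_⟩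
    · calc _ ≤ ‖q' - q - A (t • h)‖ * ‖h‖ := abs_real_inner_le_norm _ _
        _ ≤ γ * ‖h‖ * ‖h‖ := by
          gcongr
          exact hq2.trans (by gcongr)
        _ = _ := by ring
    · have := hq' (z + s • h)
      have e : z + s • h - (z + t • h) = (s - t) • h := by module
      rw [e, real_inner_smul_right] at this
      have e2 : ⟪q, h⟫ + t * ⟪A h, h⟫ + ⟪q' - q - A (t • h), h⟫ = ⟪q', h⟫ := by
        simp only [inner_sub_left, map_smul, real_inner_smul_left]; ring
      rwa [e2]
  have up : ψ 1 - ψ 0 ≤ γ * ‖h‖ ^ 2 := by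
    refine sub_le_of_increment_le (K := 1 / 2 * ⟪A h, h⟫) fun s t hs hst ht => ?_
    obtain ⟨e, he, h1⟩ := slope t (hs.trans hst) ht
    have h2 := h1 s
    have h3 : e * (t - s) ≤ γ * ‖h‖ ^ 2 * (t - s) :=
      mul_le_mul_of_nonneg_right ((le_abs_self e).trans he) (sub_nonneg.2 hst)
    simp only [hψ]
    linarith
  have low : (fun t => -ψ t) 1 - (fun t => -ψ t) 0 ≤ γ * ‖h‖ ^ 2 := by
    refine sub_le_of_increment_le (ψ := fun t => -ψ t) (K := 1 / 2 * ⟪A h, h⟫)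
      fun s t hs hst ht => ?_
    obtain ⟨e, he, h1⟩ := slope s hs (hst.trans ht)
    have h2 := h1 t
    have h3 : -e * (t - s) ≤ γ * ‖h‖ ^ 2 * (t - s) :=
      mul_le_mul_of_nonneg_right ((neg_le_abs e).trans he) (sub_nonneg.2 hst)
    simp only [hψ]
    linarith
  simp only [hψ] at up low
  norm_num at up low
  rw [abs_le]
  constructor <;> linarith

/-- A map which is differentiable at `q` and expands distances from `q` has an inverse first-order
expansion. -/
theorem exists_inverse_expansion [FiniteDimensional ℝ E] {J : E → E} {q : E} {L : ℝ} (hL : 0 < L)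
    (hd : DifferentiableAt ℝ J q) (hJ : ∀ q', ‖q' - q‖ ≤ L * ‖J q' - J q‖) :
    ∃ A : E →L[ℝ] E, ∀ γ > 0, ∃ r > 0, ∀ q', ‖J q' - J q‖ < r →
      ‖q' - q - A (J q' - J q)‖ ≤ γ * ‖J q' - J q‖ := by
  set B := fderiv ℝ J q with hB
  have exp : ∀ ε > 0, ∃ r > 0, ∀ q', ‖q' - q‖ < r →
      ‖J q' - J q - B (q' - q)‖ ≤ ε * ‖q' - q‖ := by
    intro ε hε
    have := (hasFDerivAt_iff_isLittleO.1 hd.hasFDerivAt).def hε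
    rw [Metric.eventually_nhds_iff] at this
    obtain ⟨r, hr, h⟩ := this
    exact ⟨r, hr, fun q' hq' => h (by rwa [dist_eq_norm])⟩
  have inj : Function.Injective B := by
    rw [injective_iff_map_eq_zero]
    intro k hk
    by_contra hk0
    have hkn : 0 < ‖k‖ := norm_pos_iff.2 hk0
    obtain ⟨r, hr, h⟩ := exp (1 / (2 * L)) (by positivity)
    set t := r / (2 * ‖k‖) with ht
    have ht0 : 0 < t := by positivity
    have hn : ‖t • k‖ = r / 2 := by
      rw [norm_smul, Real.norm_eq_abs, abs_of_pos ht0, ht]; field_simp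
    have h1 := h (q + t • k) (by simp only [add_sub_cancel_left]; rw [hn]; linarith)
    have h2 := hJ (q + t • k)
    simp only [add_sub_cancel_left, map_smul, hk, smul_zero, sub_zero] at h1 h2
    rw [hn] at h1 h2
    have h3 : L * ‖J (q + t • k) - J q‖ ≤ L * (1 / (2 * L) * (r / 2)) := by gcongr
    have e : L * (1 / (2 * L) * (r / 2)) = r / 4 := by field_simp; ring
    linarith
  let e := (LinearEquiv.ofInjectiveEndo (B : E →ₗ[ℝ] E) inj).symm
  let A : E →L[ℝ] E := LinearMap.toContinuousLinearMap (e : E →ₗ[ℝ] E)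
  have hAB : ∀ k, A (B k) = k := fun k =>
    (LinearEquiv.ofInjectiveEndo (B : E →ₗ[ℝ] E) inj).symm_apply_apply k
  refine ⟨A, fun γ hγ => ?_⟩
  set ε := γ / ((‖A‖ + 1) * L) with hε
  have hε0 : 0 < ε := by positivity
  obtain ⟨r, hr, h⟩ := exp ε hε0
  refine ⟨r / L, by positivity, fun q' hq' => ?_⟩
  have h1 := hJ q'
  have h2 := h q' (h1.trans_lt (by rwa [lt_div_iff₀' hL] at hq'))
  have e1 : q' - q - A (J q' - J q) = -A (J q' - J q - B (q' - q)) := by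
    rw [map_sub A _ (B (q' - q)), hAB]; abel
  rw [e1, norm_neg]
  calc _ ≤ ‖A‖ * ‖J q' - J q - B (q' - q)‖ := A.le_opNorm _
    _ ≤ (‖A‖ + 1) * (ε * (L * ‖J q' - J q‖)) := by
      gcongr
      · linarith
      · exact h2.trans (by gcongr)
    _ = γ * ‖J q' - J q‖ := by rw [hε]; field_simp

/-- Combination of Jensen's lemma and Alexandrov's theorem: a semiconvex function with quadratic
decay is maximal, after an arbitrarily small tilt, at a point of second-order
differentiability. -/
theorem exists_tilted_max_second_order [FiniteDimensional ℝ E] {f : E → ℝ} {M C c : ℝ}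
    (hM : 0 < M) (hf : HasParaboloidSupport (-M) f) (hc : 0 < c)
    (hco : ∀ w, f w ≤ C - c * ‖w‖ ^ 2) {δ : ℝ} (hδ : 0 < δ) :
    ∃ (p z : E) (A : E →L[ℝ] E), ‖p‖ < δ ∧ (∀ w, f w ≤ f z + ⟪p, w - z⟫) ∧
      ∀ γ > 0, ∃ r > 0, ∀ h : E, ‖h‖ < r →
        |f (z + h) - f z - ⟪p, h⟫ - 1 / 2 * ⟪A h, h⟫| ≤ γ * ‖h‖ ^ 2 := by
  set g : E → ℝ := fun z => f z + M * ‖z‖ ^ 2 with hgdef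
  have hg : HasParaboloidSupport M g := by
    have := hf.add_norm_sq M
    rwa [show -M + 2 * M = M by ring] at this
  have hfc := hf.continuous
  have hsq : ∀ z w : E, ‖w‖ ^ 2 = ‖z‖ ^ 2 + 2 * ⟪z, w - z⟫ + ‖w - z‖ ^ 2 := fun z w => by
    rw [← norm_add_sq_real]; simp
  have hmin : ∀ q : E, ∃ z, ∀ w, g z + ⟪q, w - z⟫ ≤ g w := by
    intro q
    obtain ⟨r, hr⟩ := hg 0
    obtain ⟨z, hz⟩ := exists_tilted_max (f := fun w => -(g w) + ⟪r, w⟫) (C := -(g 0)) (c := M / 2)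
      (by fun_prop) (by positivity) (fun w => by have := hr w; simp at this; linarith) (r - q)
    refine ⟨z, fun w => ?_⟩
    have := hz w
    simp only [inner_sub_left, inner_sub_right] at this ⊢
    linarith
  choose J hJ using hmin
  have hJlip : ∀ q q', ‖J q - J q'‖ ≤ 2 / M * ‖q - q'‖ := fun q q' =>
    hg.norm_sub_le_of_min hM (hJ q) (hJ q')
  have hJeq : ∀ q z, (∀ w, g z + ⟪q, w - z⟫ ≤ g w) → J q = z := fun q z hz => by
    have := hg.norm_sub_le_of_min hM (hJ q) hz
    simp only [sub_self, norm_zero, mul_zero] at this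
    exact sub_eq_zero.1 (norm_le_zero_iff.1 this)
  set T : E → E := fun q => q - (2 * M) • J q with hT
  have hTlip : LipschitzWith 5 T := by
    refine LipschitzWith.of_dist_le_mul fun q q' => ?_
    rw [dist_eq_norm, dist_eq_norm]
    have e : T q - T q' = (q - q') - (2 * M) • (J q - J q') := by simp only [hT]; module
    rw [e]
    calc _ ≤ ‖q - q'‖ + ‖(2 * M) • (J q - J q')‖ := norm_sub_le _ _
      _ = ‖q - q'‖ + 2 * M * ‖J q - J q'‖ := by
        rw [norm_smul, Real.norm_eq_abs, abs_of_pos (by positivity)]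
      _ ≤ ‖q - q'‖ + 2 * M * (2 / M * ‖q - q'‖) := by gcongr; exact hJlip q q'
      _ = 5 * ‖q - q'‖ := by field_simp; ring
  set Q : Set E := {q | ‖T q‖ < δ ∧ ∀ w, f w ≤ f (J q) + ⟪T q, w - J q⟫} with hQ
  have himg : ball (0 : E) δ ⊆ T '' Q := by
    intro p hp
    rw [mem_ball_zero_iff] at hp
    obtain ⟨z, hz⟩ := exists_tilted_max hfc hc hco p
    obtain ⟨r, hr⟩ := hf z
    have hrp : r = p := by
      have h1 := hz (z + (1 / M) • (r - p))
      have h2 := hr (z + (1 / M) • (r - p))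
      simp only [add_sub_cancel_left] at h1 h2
      have e3 : ⟪r - p, (1 / M) • (r - p)⟫ = 1 / M * ‖r - p‖ ^ 2 := by
        rw [real_inner_smul_right, real_inner_self_eq_norm_sq]
      have e4 : ‖(1 / M) • (r - p)‖ ^ 2 = (1 / M) ^ 2 * ‖r - p‖ ^ 2 := by
        rw [norm_smul, mul_pow, Real.norm_eq_abs, sq_abs]
      have e5 : -M / 2 * ((1 / M) ^ 2 * ‖r - p‖ ^ 2) = -(1 / 2 * (1 / M * ‖r - p‖ ^ 2)) := by
        field_simp
      rw [e4, e5] at h2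
      rw [inner_sub_left] at e3
      have h6 : 1 / M * ‖r - p‖ ^ 2 ≤ 0 := by linarith
      have h7 : ‖r - p‖ ^ 2 ≤ 0 := by
        by_contra hcon
        have : 0 < 1 / M * ‖r - p‖ ^ 2 := mul_pos (by positivity) (not_le.1 hcon)
        linarith
      have h8 : ‖r - p‖ = 0 := pow_eq_zero_iff two_ne_zero |>.1 (le_antisymm h7 (by positivity))
      exact sub_eq_zero.1 (norm_eq_zero.1 h8)
    subst hrp
    have hJz : J (r + (2 * M) • z) = z := by
      refine hJeq _ _ fun w => ?_
      have h1 := hr w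
      have h2 := hsq z w
      have h3 : 0 ≤ M * ‖w - z‖ ^ 2 := by positivity
      simp only [hgdef, inner_add_left, real_inner_smul_left]
      rw [h2]
      linarith
    have hTr : T (r + (2 * M) • z) = r := by simp only [hT]; rw [hJz]; abel
    refine ⟨r + (2 * M) • z, ⟨by rwa [hTr], ?_⟩, hTr⟩
    rwa [hTr, hJz]
  obtain ⟨q, hqQ, hqd⟩ : ∃ q ∈ Q, DifferentiableAt ℝ J q := by
    borelize E
    let μ : Measure E := Measure.hausdorffMeasure (Module.finrank ℝ E : ℝ)
    have : μ.IsAddHaarMeasure := isAddHaarMeasure_hausdorffMeasure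
    have hJL : LipschitzWith (Real.toNNReal (2 / M)) J := by
      refine LipschitzWith.of_dist_le_mul fun q q' => ?_
      rw [dist_eq_norm, dist_eq_norm, Real.coe_toNNReal _ (by positivity)]
      exact hJlip q q'
    have hae : ∀ᵐ q ∂μ, DifferentiableAt ℝ J q := hJL.ae_differentiableAt
    by_contra hcon
    push Not at hcon
    have hQ0 : μ Q = 0 := measure_mono_null (fun q hq => hcon q hq) hae
    have h1 : μ (T '' Q) = 0 := by
      have := hTlip.hausdorffMeasure_image_le (d := (Module.finrank ℝ E : ℝ)) (by positivity) Q
      change μ (T '' Q) ≤ _ * μ Q at this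
      rw [hQ0, mul_zero] at this
      exact le_antisymm this zero_le
    have h2 : μ (ball (0 : E) δ) = 0 := measure_mono_null himg h1
    exact (measure_ball_pos μ (0 : E) hδ).ne' h2
  obtain ⟨hqδ, hqmax⟩ := hqQ
  have hup : ∀ w, g w ≤ g (J q) + ⟪q, w - J q⟫ + M * ‖w - J q‖ ^ 2 := by
    intro w
    have h1 := hqmax w
    simp only [hgdef]
    rw [hsq (J q) w]
    simp only [hT, inner_sub_left, real_inner_smul_left] at h1
    linarith
  obtain ⟨A, hA⟩ := exists_inverse_expansion (L := 4 * M) (by positivity) hqd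
    fun q' => norm_sub_le_of_touching_above hM (hJ q) (hJ q') hup
  have hexp := second_order_of_slopes (g := g) (z := J q) (q := q) (A := A) (fun γ hγ => by
    obtain ⟨r, hr, h⟩ := hA γ hγ
    refine ⟨r, hr, fun k hk => ?_⟩
    obtain ⟨q', hq'⟩ := hg (J q + k)
    have hmin' : ∀ w, g (J q + k) + ⟪q', w - (J q + k)⟫ ≤ g w := fun w =>
      (le_add_of_nonneg_right (by positivity)).trans (hq' w)
    refine ⟨q', hmin', ?_⟩
    have hJq' := hJeq q' _ hmin'
    have := h q'
    rw [hJq', add_sub_cancel_left] at this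
    exact this hk)
  refine ⟨T q, J q, A - (2 * M) • ContinuousLinearMap.id ℝ E, hqδ, hqmax, fun γ hγ => ?_⟩
  obtain ⟨r, hr, h⟩ := hexp γ hγ
  refine ⟨r, hr, fun k hk => ?_⟩
  have h1 := h k hk
  have h2 := hsq (J q) (J q + k)
  rw [add_sub_cancel_left] at h2
  have e : g (J q + k) - g (J q) - ⟪q, k⟫ - 1 / 2 * ⟪A k, k⟫ =
      f (J q + k) - f (J q) - ⟪T q, k⟫ -
        1 / 2 * ⟪(A - (2 * M) • ContinuousLinearMap.id ℝ E) k, k⟫ := by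
    simp only [hgdef, hT, h2, inner_sub_left, real_inner_smul_left,
      sub_apply, smul_apply, ContinuousLinearMap.id_apply,
      real_inner_self_eq_norm_sq]
    ring
  rwa [← e]

theorem inner_self_nonneg_of_small {B : E →L[ℝ] E}
    (H : ∀ γ > 0, ∃ r > 0, ∀ h : E, ‖h‖ < r → 0 ≤ ⟪B h, h⟫ + γ * ‖h‖ ^ 2) (h : E) :
    0 ≤ ⟪B h, h⟫ := by
  rcases eq_or_ne h 0 with rfl | h0
  · simp
  have hn : 0 < ‖h‖ := norm_pos_iff.2 h0
  refine le_of_forall_pos_le_add fun ε hε => ?_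
  obtain ⟨r, hr, hB⟩ := H (ε / ‖h‖ ^ 2) (by positivity)
  set t := r / (2 * ‖h‖) with ht
  have ht0 : 0 < t := by positivity
  have h1 := hB (t • h) (by
    rw [norm_smul, Real.norm_eq_abs, abs_of_pos ht0, ht]
    have : r / (2 * ‖h‖) * ‖h‖ = r / 2 := by field_simp
    linarith)
  rw [map_smul, real_inner_smul_left, real_inner_smul_right, norm_smul, mul_pow,
    Real.norm_eq_abs, sq_abs] at h1
  have e : t * (t * ⟪B h, h⟫) + ε / ‖h‖ ^ 2 * (t ^ 2 * ‖h‖ ^ 2) = t ^ 2 * (⟪B h, h⟫ + ε) := by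
    field_simp
  rw [e] at h1
  exact nonneg_of_mul_nonneg_right h1 (by positivity)

theorem exists_symmetric_inner_self_eq [FiniteDimensional ℝ E] (B : E →L[ℝ] E) :
    ∃ A : E →L[ℝ] E, (∀ h k, ⟪A h, k⟫ = ⟪A k, h⟫) ∧ ∀ h, ⟪A h, h⟫ = ⟪B h, h⟫ := by
  have := FiniteDimensional.complete ℝ E
  refine ⟨(2⁻¹ : ℝ) • (B + ContinuousLinearMap.adjoint B), fun h k => ?_, fun h => ?_⟩
  · simp only [smul_apply, add_apply, real_inner_smul_left,
      inner_add_left, ContinuousLinearMap.adjoint_inner_left]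
    rw [real_inner_comm (B k) h, real_inner_comm (B h) k]
    ring
  · simp only [smul_apply, add_apply, real_inner_smul_left,
      inner_add_left, ContinuousLinearMap.adjoint_inner_left]
    rw [real_inner_comm (B h) h]
    ring

theorem norm_le_of_symmetric_of_abs_inner_self_le {X : E →L[ℝ] E}
    (hX : ∀ h k, ⟪X h, k⟫ = ⟪X k, h⟫) {R : ℝ} (hR : 0 < R)
    (hb : ∀ h, |⟪X h, h⟫| ≤ R * ‖h‖ ^ 2) : ‖X‖ ≤ R := by
  refine X.opNorm_le_bound hR.le fun u => ?_
  have h1 := (abs_le.1 (hb (u + (1 / R) • X u))).2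
  have h2 := (abs_le.1 (hb (u - (1 / R) • X u))).1
  have hs := parallelogram_law_with_norm ℝ u ((1 / R) • X u)
  have e0 : ‖(1 / R) • X u‖ ^ 2 = (1 / R) ^ 2 * ‖X u‖ ^ 2 := by
    rw [norm_smul, mul_pow, Real.norm_eq_abs, sq_abs]
  rw [e0] at hs
  have e1 : ⟪X u, (1 / R) • X u⟫ = 1 / R * ‖X u‖ ^ 2 := by
    rw [real_inner_smul_right, real_inner_self_eq_norm_sq]
  have e2 := hX u ((1 / R) • X u)
  simp only [map_add, map_sub, inner_add_left, inner_add_right, inner_sub_left,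
    inner_sub_right] at h1 h2
  have h3 : 4 * (1 / R * ‖X u‖ ^ 2) ≤ 2 * R * (‖u‖ ^ 2 + (1 / R) ^ 2 * ‖X u‖ ^ 2) := by
    nlinarith
  have e3 : 2 * R * (‖u‖ ^ 2 + (1 / R) ^ 2 * ‖X u‖ ^ 2) =
      2 * R * ‖u‖ ^ 2 + 2 * (1 / R * ‖X u‖ ^ 2) := by
    field_simp
  have h4 : 1 / R * ‖X u‖ ^ 2 ≤ R * ‖u‖ ^ 2 := by linarith
  rw [div_mul_eq_mul_div, one_mul, div_le_iff₀ hR] at h4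
  refine abs_le_of_sq_le_sq' (by nlinarith) (by positivity) |>.2

/-- `(P, X)` is a second-order superjet of `a` at `ξ` relative to `K`. -/
def UpperJet (a : E → ℝ) (K : Set E) (ξ P : E) (X : E →L[ℝ] E) : Prop :=
  ∀ γ > 0, ∃ r > 0, ∀ h : E, ‖h‖ < r → ξ + h ∈ K →
    a (ξ + h) ≤ a ξ + ⟪P, h⟫ + 1 / 2 * ⟪X h, h⟫ + γ * ‖h‖ ^ 2

/-- `A` is the sup-convolution of `a` over `K`, with the supremum attained. -/
def IsSupConvolution (a : E → ℝ) (K : Set E) (c : ℝ) (A : E → ℝ) : Prop :=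
  (∀ x, ∀ ξ ∈ K, a ξ - c * ‖x - ξ‖ ^ 2 ≤ A x) ∧ ∀ x, ∃ ξ ∈ K, A x = a ξ - c * ‖x - ξ‖ ^ 2

theorem exists_isSupConvolution {a : E → ℝ} {K : Set E} (hK : IsCompact K) (hne : K.Nonempty)
    (ha : UpperSemicontinuousOn a K) (c : ℝ) : ∃ A, IsSupConvolution a K c A := by
  have : ∀ x, ∃ ξ ∈ K, IsMaxOn (fun ξ => a ξ + -(c * ‖x - ξ‖ ^ 2)) K ξ := fun x =>
    (ha.add (Continuous.continuousOn (by fun_prop)).upperSemicontinuousOn).exists_isMaxOn hne hK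
  choose s hs hmax using this
  refine ⟨fun x => a (s x) - c * ‖x - s x‖ ^ 2, fun x ξ hξ => ?_, fun x => ⟨s x, hs x, rfl⟩⟩
  have := hmax x hξ
  simpa [sub_eq_add_neg] using this

theorem IsSupConvolution.hasParaboloidSupport {a A : E → ℝ} {K : Set E} {c : ℝ}
    (h : IsSupConvolution a K c A) : HasParaboloidSupport (-(2 * c)) A := by
  intro z
  obtain ⟨ξ, hξ, e⟩ := h.2 z
  refine ⟨-((2 * c) • (z - ξ)), fun w => ?_⟩
  have h1 := h.1 w ξ hξ
  have e1 : ‖w - ξ‖ ^ 2 = ‖z - ξ‖ ^ 2 + 2 * ⟪z - ξ, w - z⟫ + ‖w - z‖ ^ 2 := by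
    rw [← norm_add_sq_real]; simp
  rw [inner_neg_left, real_inner_smul_left]
  rw [e1] at h1
  linarith

theorem IsSupConvolution.decay {a A : E → ℝ} {K : Set E} {c : ℝ} (hc : 0 < c)
    (h : IsSupConvolution a K c A) {S R : ℝ} (hS : ∀ ξ ∈ K, a ξ ≤ S) (hR : ∀ ξ ∈ K, ‖ξ‖ ≤ R)
    (x : E) : A x ≤ S + c * R ^ 2 - c / 2 * ‖x‖ ^ 2 := by
  obtain ⟨ξ, hξ, e⟩ := h.2 x
  have h1 := hS ξ hξ
  have h2 : ‖ξ‖ ^ 2 ≤ R ^ 2 := by gcongr; exact hR ξ hξ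
  have h3 : ‖x‖ ^ 2 ≤ 2 * ‖x - ξ‖ ^ 2 + 2 * ‖ξ‖ ^ 2 := by
    have h4 : ‖x‖ ≤ ‖x - ξ‖ + ‖ξ‖ := by simpa using norm_add_le (x - ξ) ξ
    nlinarith [sq_nonneg (‖x - ξ‖ - ‖ξ‖), norm_nonneg x, norm_nonneg (x - ξ), norm_nonneg ξ]
  have h5 := mul_le_mul_of_nonneg_left h3 hc.le
  have h6 := mul_le_mul_of_nonneg_left h2 hc.le
  linarith

/-- Superjets of a sup-convolution transfer to the maximizing point. -/
theorem IsSupConvolution.upperJet {a A : E → ℝ} {K : Set E} {c : ℝ}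
    (h : IsSupConvolution a K c A) {x ξ P : E} {X : E →L[ℝ] E}
    (e : A x = a ξ - c * ‖x - ξ‖ ^ 2) (hA : UpperJet A univ x P X) : UpperJet a K ξ P X := by
  intro γ hγ
  obtain ⟨r, hr, H⟩ := hA γ hγ
  refine ⟨r, hr, fun k hk hkK => ?_⟩
  have h1 := H k hk (mem_univ _)
  have h2 := h.1 (x + k) _ hkK
  rw [add_sub_add_right_eq_sub] at h2
  linarith

/-- A superjet of a function with supporting paraboloids is bounded below. -/
theorem HasParaboloidSupport.le_inner_of_upperJet {A : E → ℝ} {m : ℝ}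
    (hA : HasParaboloidSupport m A) {x P : E} {X : E →L[ℝ] E} (hX : UpperJet A univ x P X)
    (h : E) : m * ‖h‖ ^ 2 ≤ ⟪X h, h⟫ := by
  obtain ⟨q, hq⟩ := hA x
  have := inner_self_nonneg_of_small (B := X - m • ContinuousLinearMap.id ℝ E)
    (fun γ hγ => by
      obtain ⟨r, hr, H⟩ := hX (γ / 2) (by positivity)
      refine ⟨r, hr, fun k hk => ?_⟩
      have h1 := H k hk (mem_univ _)
      have h2 := H (-k) (by rwa [norm_neg]) (mem_univ _)
      have h3 := hq (x + k)
      have h4 := hq (x + -k)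
      simp only [add_sub_cancel_left, inner_neg_right, norm_neg, map_neg, inner_neg_left,
        neg_neg] at h1 h2 h3 h4
      simp only [sub_apply, smul_apply, ContinuousLinearMap.id_apply, inner_sub_left,
        real_inner_smul_left, real_inner_self_eq_norm_sq]
      linarith) h
  simp only [sub_apply, smul_apply, ContinuousLinearMap.id_apply, inner_sub_left,
    real_inner_smul_left, real_inner_self_eq_norm_sq] at this
  linarith

/-- The theorem on sums, for near-maximal points of the doubled functional
`a₁ ξ + a₂ ζ - c ‖x - ξ‖² - c ‖y - ζ‖² - c ‖x - y‖²`. -/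
theorem exists_opposed_upperJets [FiniteDimensional ℝ E] {K : Set E} (hK : IsCompact K)
    (hne : K.Nonempty) {a₁ a₂ : E → ℝ} (h₁ : UpperSemicontinuousOn a₁ K)
    (h₂ : UpperSemicontinuousOn a₂ K) {c δ : ℝ} (hc : 0 < c) (hδ : 0 < δ) :
    ∃ (x y ξ ζ p₁ p₂ : E) (X Y : E →L[ℝ] E), ξ ∈ K ∧ ζ ∈ K ∧ ‖p₁‖ < δ ∧ ‖p₂‖ < δ ∧
      (∀ h k, ⟪X h, k⟫ = ⟪X k, h⟫) ∧ (∀ h k, ⟪Y h, k⟫ = ⟪Y k, h⟫) ∧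
      UpperJet a₁ K ξ (p₁ + (2 * c) • (x - y)) X ∧
      UpperJet a₂ K ζ (p₂ - (2 * c) • (x - y)) Y ∧
      (∀ h, ⟪X h, h⟫ + ⟪Y h, h⟫ ≤ 0) ∧
      (∀ h, -(2 * c) * ‖h‖ ^ 2 ≤ ⟪X h, h⟫) ∧ (∀ h, -(2 * c) * ‖h‖ ^ 2 ≤ ⟪Y h, h⟫) ∧
      ∀ w ∈ K, a₁ w + a₂ w ≤ a₁ ξ + a₂ ζ - c * ‖x - ξ‖ ^ 2 - c * ‖y - ζ‖ ^ 2 - c * ‖x - y‖ ^ 2 +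
        δ * (‖w - x‖ + ‖w - y‖) := by
  obtain ⟨A₁, hA₁⟩ := exists_isSupConvolution hK hne h₁ c
  obtain ⟨A₂, hA₂⟩ := exists_isSupConvolution hK hne h₂ c
  obtain ⟨m₁, -, hm₁⟩ := h₁.exists_isMaxOn hne hK
  obtain ⟨m₂, -, hm₂⟩ := h₂.exists_isMaxOn hne hK
  obtain ⟨R, hR⟩ := hK.isBounded.exists_norm_le
  have hin : ∀ V W : WithLp 2 (E × E), ⟪V, W⟫ = ⟪V.fst, W.fst⟫ + ⟪V.snd, W.snd⟫ :=
    WithLp.prod_inner_apply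
  obtain ⟨mk, hfst, hsnd⟩ : ∃ mk : E → E → WithLp 2 (E × E),
      (∀ a b, (mk a b).fst = a) ∧ ∀ a b, (mk a b).snd = b :=
    ⟨fun a b => WithLp.toLp 2 (a, b), fun _ _ => rfl, fun _ _ => rfl⟩
  let f : WithLp 2 (E × E) → ℝ := fun Z => A₁ Z.fst + A₂ Z.snd - c * ‖Z.fst - Z.snd‖ ^ 2
  have hf : HasParaboloidSupport (-(6 * c)) f := by
    intro Z
    obtain ⟨q₁, hq₁⟩ := hA₁.hasParaboloidSupport Z.fst
    obtain ⟨q₂, hq₂⟩ := hA₂.hasParaboloidSupport Z.snd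
    refine ⟨mk (q₁ - (2 * c) • (Z.fst - Z.snd)) (q₂ + (2 * c) • (Z.fst - Z.snd)),
      fun W => ?_⟩
    have h1 := hq₁ W.fst
    have h2 := hq₂ W.snd
    have e1 : ‖W.fst - W.snd‖ ^ 2 = ‖Z.fst - Z.snd‖ ^ 2 +
        2 * ⟪Z.fst - Z.snd, (W.fst - Z.fst) - (W.snd - Z.snd)⟫ +
          ‖(W.fst - Z.fst) - (W.snd - Z.snd)‖ ^ 2 := by
      rw [← norm_add_sq_real]; congr 2; abel
    have e2 : ‖(W.fst - Z.fst) - (W.snd - Z.snd)‖ ^ 2 ≤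
        2 * (‖W.fst - Z.fst‖ ^ 2 + ‖W.snd - Z.snd‖ ^ 2) := by
      have := parallelogram_law_with_norm ℝ (W.fst - Z.fst) (W.snd - Z.snd)
      nlinarith [norm_nonneg ((W.fst - Z.fst) + (W.snd - Z.snd))]
    have e3 := mul_le_mul_of_nonneg_left e2 hc.le
    simp only [f, WithLp.prod_norm_sq_eq_of_L2, hin, hfst, hsnd, WithLp.sub_fst,
      WithLp.sub_snd]
    rw [e1, inner_sub_right _ (W.fst - Z.fst), inner_sub_left q₁, inner_add_left,
      real_inner_smul_left, real_inner_smul_left]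
    linarith
  have hco : ∀ Z, f Z ≤ (a₁ m₁ + c * R ^ 2 + (a₂ m₂ + c * R ^ 2)) - c / 2 * ‖Z‖ ^ 2 := by
    intro Z
    have h1 := hA₁.decay hc (fun ξ hξ => hm₁ hξ) hR Z.fst
    have h2 := hA₂.decay hc (fun ξ hξ => hm₂ hξ) hR Z.snd
    have h3 : 0 ≤ c * ‖Z.fst - Z.snd‖ ^ 2 := by positivity
    simp only [f, WithLp.prod_norm_sq_eq_of_L2]
    linarith
  obtain ⟨p, Z, B, hp, hmax, hexp⟩ := exists_tilted_max_second_order (by positivity) hf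
    (half_pos hc) hco hδ
  set x := Z.fst with hx
  set y := Z.snd with hy
  obtain ⟨ξ, hξ, eξ⟩ := hA₁.2 x
  obtain ⟨ζ, hζ, eζ⟩ := hA₂.2 y
  let i₁ : E →L[ℝ] WithLp 2 (E × E) :=
    ((WithLp.prodContinuousLinearEquiv 2 ℝ E E).symm : E × E →L[ℝ] WithLp 2 (E × E)).comp
      (ContinuousLinearMap.inl ℝ E E)
  let i₂ : E →L[ℝ] WithLp 2 (E × E) :=
    ((WithLp.prodContinuousLinearEquiv 2 ℝ E E).symm : E × E →L[ℝ] WithLp 2 (E × E)).comp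
      (ContinuousLinearMap.inr ℝ E E)
  have hi₁ : ∀ h, (i₁ h).fst = h ∧ (i₁ h).snd = 0 := fun h => ⟨rfl, rfl⟩
  have hi₂ : ∀ h, (i₂ h).fst = 0 ∧ (i₂ h).snd = h := fun h => ⟨rfl, rfl⟩
  let π₁ : WithLp 2 (E × E) →L[ℝ] E := (ContinuousLinearMap.fst ℝ E E).comp
    (WithLp.prodContinuousLinearEquiv 2 ℝ E E : WithLp 2 (E × E) →L[ℝ] E × E)
  let π₂ : WithLp 2 (E × E) →L[ℝ] E := (ContinuousLinearMap.snd ℝ E E).comp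
    (WithLp.prodContinuousLinearEquiv 2 ℝ E E : WithLp 2 (E × E) →L[ℝ] E × E)
  have hπ₁ : ∀ W, π₁ W = W.fst := fun W => rfl
  have hπ₂ : ∀ W, π₂ W = W.snd := fun W => rfl
  obtain ⟨X, hXs, hX⟩ := exists_symmetric_inner_self_eq
    (π₁.comp (B.comp i₁) + (2 * c) • ContinuousLinearMap.id ℝ E)
  obtain ⟨Y, hYs, hY⟩ := exists_symmetric_inner_self_eq
    (π₂.comp (B.comp i₂) + (2 * c) • ContinuousLinearMap.id ℝ E)
  have exp₁ : ∀ γ > 0, ∃ r > 0, ∀ h : E, ‖h‖ < r →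
      |A₁ (x + h) - A₁ x - ⟪p.fst + (2 * c) • (x - y), h⟫ - 1 / 2 * ⟪X h, h⟫| ≤ γ * ‖h‖ ^ 2 := by
    intro γ hγ
    obtain ⟨r, hr, H⟩ := hexp γ hγ
    refine ⟨r, hr, fun h hh => ?_⟩
    have hn : ‖i₁ h‖ = ‖h‖ := WithLp.norm_toLp_fst 2 E E h
    have h1 := H (i₁ h) (by rwa [hn])
    rw [hn] at h1
    convert h1 using 2
    have e1 : ‖x + h - y‖ ^ 2 = ‖x - y‖ ^ 2 + 2 * ⟪x - y, h⟫ + ‖h‖ ^ 2 := by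
      rw [← norm_add_sq_real]; congr 2; abel
    rw [hX]
    simp only [add_apply, ContinuousLinearMap.comp_apply, smul_apply,
      ContinuousLinearMap.id_apply, hπ₁, hi₁, f, hin, WithLp.add_fst,
      WithLp.add_snd, inner_add_left, real_inner_smul_left, real_inner_self_eq_norm_sq,
      inner_zero_right, add_zero, ← hx, ← hy, e1]
    ring
  have exp₂ : ∀ γ > 0, ∃ r > 0, ∀ h : E, ‖h‖ < r →
      |A₂ (y + h) - A₂ y - ⟪p.snd - (2 * c) • (x - y), h⟫ - 1 / 2 * ⟪Y h, h⟫| ≤ γ * ‖h‖ ^ 2 := by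
    intro γ hγ
    obtain ⟨r, hr, H⟩ := hexp γ hγ
    refine ⟨r, hr, fun h hh => ?_⟩
    have hn : ‖i₂ h‖ = ‖h‖ := WithLp.norm_toLp_snd 2 E E h
    have h1 := H (i₂ h) (by rwa [hn])
    rw [hn] at h1
    convert h1 using 2
    have e1 : ‖x - (y + h)‖ ^ 2 = ‖x - y‖ ^ 2 - 2 * ⟪x - y, h⟫ + ‖h‖ ^ 2 := by
      rw [← norm_sub_sq_real]; congr 2; abel
    rw [hY]
    simp only [add_apply, ContinuousLinearMap.comp_apply, smul_apply,
      ContinuousLinearMap.id_apply, hπ₂, hi₂, f, hin, WithLp.add_fst,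
      WithLp.add_snd, inner_add_left, inner_sub_left, real_inner_smul_left,
      real_inner_self_eq_norm_sq, inner_zero_right, add_zero, zero_add, ← hx, ← hy, e1]
    ring
  have jet₁ : UpperJet A₁ univ x (p.fst + (2 * c) • (x - y)) X := fun γ hγ => by
    obtain ⟨r, hr, H⟩ := exp₁ γ hγ
    exact ⟨r, hr, fun h hh _ => by linarith [(abs_le.1 (H h hh)).2]⟩
  have jet₂ : UpperJet A₂ univ y (p.snd - (2 * c) • (x - y)) Y := fun γ hγ => by
    obtain ⟨r, hr, H⟩ := exp₂ γ hγ
    exact ⟨r, hr, fun h hh _ => by linarith [(abs_le.1 (H h hh)).2]⟩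
  refine ⟨x, y, ξ, ζ, p.fst, p.snd, X, Y, hξ, hζ, (WithLp.norm_fst_le _ p).trans_lt hp,
    (WithLp.norm_snd_le _ p).trans_lt hp, hXs, hYs, hA₁.upperJet eξ jet₁, hA₂.upperJet eζ jet₂,
    fun h => ?_, hA₁.hasParaboloidSupport.le_inner_of_upperJet jet₁,
    hA₂.hasParaboloidSupport.le_inner_of_upperJet jet₂, fun w hw => ?_⟩
  · have := inner_self_nonneg_of_small (B := -(X + Y)) (fun γ hγ => by
      obtain ⟨r₁, hr₁, H₁⟩ := exp₁ (γ / 4) (by positivity)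
      obtain ⟨r₂, hr₂, H₂⟩ := exp₂ (γ / 4) (by positivity)
      refine ⟨min r₁ r₂, lt_min hr₁ hr₂, fun k hk => ?_⟩
      have g1 := (abs_le.1 (H₁ k (hk.trans_le (min_le_left _ _)))).1
      have g2 := (abs_le.1 (H₂ k (hk.trans_le (min_le_right _ _)))).1
      have g3 := hmax (Z + mk k k)
      simp only [f, add_sub_cancel_left, hin, hfst, hsnd, WithLp.add_fst,
        WithLp.add_snd, ← hx, ← hy, add_sub_add_right_eq_sub] at g3
      simp only [neg_apply, add_apply, inner_neg_left, inner_add_left, inner_sub_left] at g1 g2 ⊢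
      linarith) h
    simp only [neg_apply, add_apply, inner_neg_left, inner_add_left] at this
    linarith
  · have g1 := hmax (mk w w)
    have g2 := hA₁.1 w w hw
    have g3 := hA₂.1 w w hw
    simp only [f, hin, hfst, hsnd, WithLp.sub_fst, WithLp.sub_snd, ← hx, ← hy, sub_self,
      norm_zero, ne_eq, OfNat.ofNat_ne_zero, not_false_eq_true, zero_pow, mul_zero,
      sub_zero] at g1 g2 g3
    have b1 : ⟪p.fst, w - x⟫ ≤ δ * ‖w - x‖ := (real_inner_le_norm _ _).trans
      (by gcongr; exact ((WithLp.norm_fst_le _ p).trans_lt hp).le)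
    have b2 : ⟪p.snd, w - y⟫ ≤ δ * ‖w - y‖ := (real_inner_le_norm _ _).trans
      (by gcongr; exact ((WithLp.norm_snd_le _ p).trans_lt hp).le)
    linarith

end Jensen

section Limit
open Topology
variable {E : Type*} [NormedAddCommGroup E] [InnerProductSpace ℝ E]

/-- If `a₁ + a₂` exceeds its boundary values at an interior point, then there is a convergent
sequence of opposed superjets of `a₁` and `a₂` based in the interior. -/
theorem exists_tendsto_opposed_upperJets [FiniteDimensional ℝ E] {Ω : Set E} (hΩ : IsOpen Ω)
    (hΩb : Bornology.IsBounded Ω) {a₁ a₂ : E → ℝ} (h₁ : UpperSemicontinuousOn a₁ (closure Ω))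
    (h₂ : UpperSemicontinuousOn a₂ (closure Ω)) {x₀ : E} (hx₀ : x₀ ∈ Ω) {κ : ℝ} (hκ : 0 < κ)
    (hbd : ∀ y ∈ frontier Ω, a₁ y + a₂ y < a₁ x₀ + a₂ x₀ - κ) :
    ∃ (ξ ζ P Q : ℕ → E) (X Y : ℕ → E →L[ℝ] E) (P₀ : E) (X₀ Y₀ : E →L[ℝ] E),
      (∀ j, ξ j ∈ Ω ∧ ζ j ∈ Ω ∧ a₁ x₀ + a₂ x₀ - κ ≤ a₁ (ξ j) + a₂ (ζ j) ∧
        UpperJet a₁ (closure Ω) (ξ j) (P j) (X j) ∧ UpperJet a₂ (closure Ω) (ζ j) (Q j) (Y j) ∧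
        (∀ h k, inner ℝ (X j h) k = inner ℝ (X j k) h) ∧
        (∀ h k, inner ℝ (Y j h) k = inner ℝ (Y j k) h) ∧
        ∀ h, inner ℝ (X j h) h + inner ℝ (Y j h) h ≤ 0) ∧
      Tendsto P atTop (𝓝 P₀) ∧ Tendsto Q atTop (𝓝 (-P₀)) ∧
      Tendsto X atTop (𝓝 X₀) ∧ Tendsto Y atTop (𝓝 Y₀) := by
  have := FiniteDimensional.proper ℝ E
  have := FiniteDimensional.proper ℝ (E →L[ℝ] E)
  have hK : IsCompact (closure Ω) := hΩb.isCompact_closure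
  have hne : (closure Ω).Nonempty := ⟨x₀, subset_closure hx₀⟩
  have hmem : ∀ y ∈ closure Ω, y ∉ Ω → y ∈ frontier Ω := fun y hy hy' => by
    rw [hΩ.frontier_eq]; exact ⟨hy, hy'⟩
  -- near-maximal pairs close to the diagonal lie in the interior
  obtain ⟨r, hr, hloc⟩ : ∃ r > 0, ∀ ξ ∈ closure Ω, ∀ ζ ∈ closure Ω, ‖ξ - ζ‖ < r →
      a₁ x₀ + a₂ x₀ - κ ≤ a₁ ξ + a₂ ζ → ξ ∈ Ω ∧ ζ ∈ Ω := by
    let W : Set (E × E) := {p | p.1 ∈ closure Ω → p.2 ∈ closure Ω →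
      a₁ p.1 + a₂ p.2 < a₁ x₀ + a₂ x₀ - κ}
    have hF : IsCompact ((fun y : E => (y, y)) '' frontier Ω) :=
      (hK.of_isClosed_subset isClosed_frontier frontier_subset_closure).image (by fun_prop)
    have hFW : (fun y : E => (y, y)) '' frontier Ω ⊆ interior W := by
      rintro _ ⟨y, hy, rfl⟩
      rw [mem_interior_iff_mem_nhds]
      have hyc := frontier_subset_closure hy
      set g := (a₁ x₀ + a₂ x₀ - κ - (a₁ y + a₂ y)) / 2 with hg
      have hgpos : 0 < g := by have := hbd y hy; rw [hg]; linarith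
      have e₁ := eventually_nhdsWithin_iff.1 (h₁ y hyc (a₁ y + g) (by linarith))
      have e₂ := eventually_nhdsWithin_iff.1 (h₂ y hyc (a₂ y + g) (by linarith))
      filter_upwards [e₁.prod_nhds e₂] with p hp h1 h2
      have := hp.1 h1
      have := hp.2 h2
      linarith
    obtain ⟨r, hr, hsub⟩ := hF.exists_thickening_subset_open isOpen_interior hFW
    refine ⟨r, hr, fun ξ hξ ζ hζ hd hs => ?_⟩
    have key : ∀ y ∈ frontier Ω, dist ξ y < r → dist ζ y < r → False := fun y hy hd1 hd2 => by
      have : (ξ, ζ) ∈ W := interior_subset (hsub (mem_thickening_iff.2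
        ⟨(y, y), mem_image_of_mem _ hy, by rw [Prod.dist_eq]; exact max_lt hd1 hd2⟩))
      exact absurd hs (not_le.2 (this hξ hζ))
    rw [← dist_eq_norm] at hd
    constructor
    · by_contra h
      exact key ξ (hmem ξ hξ h) (by simpa using hr) (by rwa [dist_comm])
    · by_contra h
      exact key ζ (hmem ζ hζ h) hd (by simpa using hr)
  obtain ⟨m₁, -, hm₁⟩ := h₁.exists_isMaxOn hne hK
  obtain ⟨m₂, -, hm₂⟩ := h₂.exists_isMaxOn hne hK
  set D := diam (closure Ω)
  have hD : 0 ≤ D := diam_nonneg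
  set G := a₁ m₁ + a₂ m₂ - (a₁ x₀ + a₂ x₀) + κ with hG
  have hGpos : 0 < G := by
    have : a₁ x₀ ≤ a₁ m₁ := hm₁ (subset_closure hx₀)
    have : a₂ x₀ ≤ a₂ m₂ := hm₂ (subset_closure hx₀)
    linarith
  set c := 1 + (3 * G + 1) / r ^ 2 with hc
  have hc1 : 1 < c := by rw [hc]; linarith [show 0 < (3 * G + 1) / r ^ 2 by positivity]
  have hc0 : 0 < c := by linarith
  have hcr : (c - 1) * r ^ 2 = 3 * G + 1 := by rw [hc]; field_simp; ring
  let δ : ℕ → ℝ := fun j => min 1 (κ / (2 * D + 2)) / ((j : ℝ) + 1)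
  have hδ₀ : 0 < min 1 (κ / (2 * D + 2)) := lt_min one_pos (by positivity)
  have hδ : ∀ j, 0 < δ j := fun j => by positivity
  have hδle : ∀ j, δ j ≤ min 1 (κ / (2 * D + 2)) := fun j =>
    div_le_self hδ₀.le (by linarith [show (0 : ℝ) ≤ j from Nat.cast_nonneg j])
  have hδlim : Tendsto δ atTop (𝓝 0) :=
    tendsto_const_nhds.div_atTop (tendsto_atTop_add_const_right _ 1 tendsto_natCast_atTop_atTop)
  choose x y ξ ζ p₁ p₂ X Y hξ hζ hp₁ hp₂ hX hY jX jY hXY hXl hYl hmax using fun j =>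
    exists_opposed_upperJets hK hne h₁ h₂ hc0 (hδ j)
  have est : ∀ j, a₁ x₀ + a₂ x₀ - κ ≤ a₁ (ξ j) + a₂ (ζ j) ∧
      (c - 1) * (‖x j - ξ j‖ ^ 2 + ‖y j - ζ j‖ ^ 2 + ‖x j - y j‖ ^ 2) ≤ G := by
    intro j
    have h0 := hmax j x₀ (subset_closure hx₀)
    have hd : ∀ z ∈ closure Ω, ∀ w, ‖x₀ - w‖ ≤ D + 1 + ‖w - z‖ ^ 2 := fun z hz w => by
      have h1 : ‖x₀ - z‖ ≤ D := by
        rw [← dist_eq_norm]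
        exact dist_le_diam_of_mem hK.isBounded (subset_closure hx₀) hz
      have h2 : ‖x₀ - w‖ ≤ ‖x₀ - z‖ + ‖z - w‖ := norm_sub_le_norm_sub_add_norm_sub _ _ _
      rw [norm_sub_rev z w] at h2
      nlinarith [sq_nonneg (‖w - z‖ - 1)]
    have h1 := hd _ (hξ j) (x j)
    have h2 := hd _ (hζ j) (y j)
    have h3 : δ j * (2 * D + 2) ≤ κ := by
      have := (hδle j).trans (min_le_right _ _)
      rwa [le_div_iff₀ (by positivity)] at this
    have h4 : δ j ≤ 1 := (hδle j).trans (min_le_left _ _)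
    have h5 : δ j * (‖x₀ - x j‖ + ‖x₀ - y j‖) ≤
        κ + (‖x j - ξ j‖ ^ 2 + ‖y j - ζ j‖ ^ 2) := by
      calc _ ≤ δ j * (2 * D + 2 + (‖x j - ξ j‖ ^ 2 + ‖y j - ζ j‖ ^ 2)) :=
            mul_le_mul_of_nonneg_left (by linarith) (hδ j).le
        _ = δ j * (2 * D + 2) + δ j * (‖x j - ξ j‖ ^ 2 + ‖y j - ζ j‖ ^ 2) := by ring
        _ ≤ _ := add_le_add h3 (mul_le_of_le_one_left (by positivity) h4)
    have h6 : 0 ≤ (c - 1) * (‖x j - ξ j‖ ^ 2 + ‖y j - ζ j‖ ^ 2 + ‖x j - y j‖ ^ 2) :=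
      mul_nonneg (by linarith) (by positivity)
    have h7 : a₁ (ξ j) ≤ a₁ m₁ := hm₁ (hξ j)
    have h8 : a₂ (ζ j) ≤ a₂ m₂ := hm₂ (hζ j)
    have h9 : 0 ≤ ‖x j - y j‖ ^ 2 := by positivity
    constructor <;> linarith
  have hin : ∀ j, ξ j ∈ Ω ∧ ζ j ∈ Ω := fun j => by
    refine hloc _ (hξ j) _ (hζ j) ?_ (est j).1
    have h1 := (est j).2
    have h2 : ‖ξ j - ζ j‖ ≤ ‖x j - ξ j‖ + ‖x j - y j‖ + ‖y j - ζ j‖ := by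
      have e : ξ j - ζ j = -(x j - ξ j) + (x j - y j) + (y j - ζ j) := by abel
      rw [e]
      exact (norm_add₃_le).trans (by rw [norm_neg])
    refine lt_of_pow_lt_pow_left₀ 2 hr.le ?_
    have h3 : ‖ξ j - ζ j‖ ^ 2 ≤
        3 * (‖x j - ξ j‖ ^ 2 + ‖y j - ζ j‖ ^ 2 + ‖x j - y j‖ ^ 2) := by
      have := pow_le_pow_left₀ (norm_nonneg _) h2 2
      nlinarith [sq_nonneg (‖x j - ξ j‖ - ‖y j - ζ j‖), sq_nonneg (‖x j - ξ j‖ - ‖x j - y j‖),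
        sq_nonneg (‖x j - y j‖ - ‖y j - ζ j‖)]
    have h4 : (c - 1) * ‖ξ j - ζ j‖ ^ 2 < (c - 1) * r ^ 2 := by
      rw [hcr]
      have := mul_le_mul_of_nonneg_left h3 (show 0 ≤ c - 1 by linarith)
      linarith
    exact lt_of_mul_lt_mul_left h4 (by linarith)
  have hXn : ∀ j, ‖X j‖ ≤ 2 * c := fun j =>
    norm_le_of_symmetric_of_abs_inner_self_le (hX j) (by positivity) fun h =>
      abs_le.2 ⟨by linarith [hXl j h], by linarith [hYl j h, hXY j h]⟩
  have hYn : ∀ j, ‖Y j‖ ≤ 2 * c := fun j =>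
    norm_le_of_symmetric_of_abs_inner_self_le (hY j) (by positivity) fun h =>
      abs_le.2 ⟨by linarith [hYl j h], by linarith [hXl j h, hXY j h]⟩
  have hxy : ∀ j, ‖x j - y j‖ ≤ 1 + G / (c - 1) := fun j => by
    have h1 : ‖x j - y j‖ ^ 2 ≤ G / (c - 1) := by
      rw [le_div_iff₀ (by linarith)]
      have := (est j).2
      have h6 : 0 ≤ (c - 1) * (‖x j - ξ j‖ ^ 2 + ‖y j - ζ j‖ ^ 2) :=
        mul_nonneg (by linarith) (by positivity)
      linarith
    nlinarith [sq_nonneg (‖x j - y j‖ - 1)]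
  obtain ⟨⟨z, X₀, Y₀⟩, -, φ, hφ, hlim⟩ := ((isCompact_closedBall (0 : E) (1 + G / (c - 1))).prod
    ((isCompact_closedBall (0 : E →L[ℝ] E) (2 * c)).prod
      (isCompact_closedBall (0 : E →L[ℝ] E) (2 * c)))).tendsto_subseq
    (x := fun j => (x j - y j, X j, Y j)) (fun j => by
      simp only [mem_prod, mem_closedBall_zero_iff]
      exact ⟨hxy j, hXn j, hYn j⟩)
  rw [nhds_prod_eq, nhds_prod_eq] at hlim
  have l₁ := hlim.fst
  have l₂ := hlim.snd.fst
  have l₃ := hlim.snd.snd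
  have hp : ∀ p : ℕ → E, (∀ j, ‖p j‖ < δ j) → Tendsto (p ∘ φ) atTop (𝓝 0) := fun p hp =>
    (squeeze_zero_norm (fun j => (hp j).le) hδlim).comp hφ.tendsto_atTop
  refine ⟨ξ ∘ φ, ζ ∘ φ, fun j => p₁ (φ j) + (2 * c) • (x (φ j) - y (φ j)),
    fun j => p₂ (φ j) - (2 * c) • (x (φ j) - y (φ j)), X ∘ φ, Y ∘ φ, (2 * c) • z, X₀, Y₀,
    fun j => ⟨(hin _).1, (hin _).2, (est _).1, jX _, jY _, hX _, hY _, hXY _⟩, ?_, ?_, l₂, l₃⟩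
  · simpa using (hp p₁ hp₁).add (l₁.const_smul (2 * c))
  · simpa using (hp p₂ hp₂).sub (l₁.const_smul (2 * c))

end Limit

section TestFunction
open Topology

/-- The matrix of the quadratic form `h ↦ ⟪X h, h⟫`. -/
def formMatrix (X : En n →L[ℝ] En n) : Sym n :=
  Matrix.of fun i j => inner ℝ (X (EuclideanSpace.single i 1)) (EuclideanSpace.single j 1)

/-- A positive function with prescribed second-order logarithmic expansion at `ξ`, shifted by
`d`. -/
def expTest (d C : ℝ) (ξ P : En n) (X : En n →L[ℝ] En n) (x : En n) : ℝ :=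
  d + C * Real.exp (inner ℝ P (x - ξ) + 1 / 2 * inner ℝ (X (x - ξ)) (x - ξ))

theorem contDiff_expTest (d C : ℝ) (ξ P : En n) (X : En n →L[ℝ] En n) :
    ContDiff ℝ 2 (expTest d C ξ P X) := by
  unfold expTest
  have h : ContDiff ℝ 2 fun x : En n => x - ξ := contDiff_id.sub contDiff_const
  exact contDiff_const.add (contDiff_const.mul (Real.contDiff_exp.comp
    ((contDiff_const.inner ℝ h).add (contDiff_const.mul ((X.contDiff.comp h).inner ℝ h)))))

theorem hasFDerivAt_expTest (d C : ℝ) (ξ P : En n) {X : En n →L[ℝ] En n}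
    (hX : ∀ h k, inner ℝ (X h) k = inner ℝ (X k) h) (x : En n) :
    HasFDerivAt (expTest d C ξ P X)
      ((C * Real.exp (inner ℝ P (x - ξ) + 1 / 2 * inner ℝ (X (x - ξ)) (x - ξ))) •
        innerSL ℝ (P + X (x - ξ))) x := by
  have h : HasFDerivAt (fun x : En n => x - ξ) (ContinuousLinearMap.id ℝ (En n)) x :=
    (hasFDerivAt_id x).sub_const ξ
  have h1 := (hasFDerivAt_const P x).inner ℝ h
  have h2 := ((X.hasFDerivAt.comp x h).inner ℝ h).const_mul (1 / 2)
  have h3 := (((h1.add h2).exp).const_mul C).const_add d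
  refine h3.congr_fderiv ?_
  ext k
  have e := hX k (x - ξ)
  simp [-map_sub, e]
  ring

theorem gradient_expTest (d C : ℝ) (ξ P : En n) {X : En n →L[ℝ] En n}
    (hX : ∀ h k, inner ℝ (X h) k = inner ℝ (X k) h) :
    gradient (expTest d C ξ P X) ξ = C • P := by
  have h := hasFDerivAt_expTest d C ξ P hX ξ
  refine ext_inner_right ℝ fun k => ?_
  rw [gradient, InnerProductSpace.toDual_symm_apply, h.fderiv]
  simp [real_inner_smul_left]

theorem ehess_expTest (d C : ℝ) (ξ P : En n) {X : En n →L[ℝ] En n}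
    (hX : ∀ h k, inner ℝ (X h) k = inner ℝ (X k) h) :
    ehess (expTest d C ξ P X) ξ = C • (formMatrix X + vouter P P) := by
  ext i j
  have hfd : (fun x => fderiv ℝ (expTest d C ξ P X) x (EuclideanSpace.single j (1:ℝ))) =
      fun x => C * Real.exp (inner ℝ P (x - ξ) + 1 / 2 * inner ℝ (X (x - ξ)) (x - ξ)) *
        inner ℝ (P + X (x - ξ)) (EuclideanSpace.single j (1:ℝ)) := by
    funext x
    rw [(hasFDerivAt_expTest d C ξ P hX x).fderiv]
    rfl
  have h : HasFDerivAt (fun x : En n => x - ξ) (ContinuousLinearMap.id ℝ (En n)) ξ :=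
    (hasFDerivAt_id ξ).sub_const ξ
  have h0 : expTest 0 C ξ P X = fun x =>
      C * Real.exp (inner ℝ P (x - ξ) + 1 / 2 * inner ℝ (X (x - ξ)) (x - ξ)) :=
    funext fun x => zero_add _
  have h1 := hasFDerivAt_expTest 0 C ξ P hX ξ
  rw [h0] at h1
  have h2 := (((X.hasFDerivAt.comp ξ h).const_add P).inner ℝ
    (hasFDerivAt_const (EuclideanSpace.single j (1:ℝ)) ξ))
  have h3 := h1.mul h2
  simp only [ehess, Matrix.of_apply]
  rw [hfd]
  refine (congrArg (fun L : En n →L[ℝ] ℝ => L (EuclideanSpace.single i 1)) h3.fderiv).trans ?_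
  simp [formMatrix, vouter, EuclideanSpace.inner_single_right]
  ring

end TestFunction

section Comparison
open Topology

section
variable {E : Type*} [NormedAddCommGroup E] [InnerProductSpace ℝ E]

/-- The operator `X + t • id`. -/
def shift (X : E →L[ℝ] E) (t : ℝ) : E →L[ℝ] E := X + t • ContinuousLinearMap.id ℝ E

theorem shift_zero (X : E →L[ℝ] E) : shift X 0 = X := by
  simp [shift]

theorem inner_shift (X : E →L[ℝ] E) (t : ℝ) (h k : E) :
    inner ℝ (shift X t h) k = inner ℝ (X h) k + t * inner ℝ h k := by
  simp [shift, inner_add_left, real_inner_smul_left]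

theorem continuous_shift (X : E →L[ℝ] E) : Continuous (shift X) := by
  unfold shift
  fun_prop

theorem symm_shift {X : E →L[ℝ] E} (hX : ∀ h k, inner ℝ (X h) k = inner ℝ (X k) h) (t : ℝ)
    (h k : E) : inner ℝ (shift X t h) k = inner ℝ (shift X t k) h := by
  rw [inner_shift, inner_shift, hX, real_inner_comm h k]

end

theorem formMatrix_neg (X : En n →L[ℝ] En n) : formMatrix (-X) = -formMatrix X := by
  ext i j
  simp [formMatrix]

theorem vouter_neg_neg (P : En n) : vouter (-P) (-P) = vouter P P := by
  ext i j
  simp [vouter]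

theorem continuous_formMatrix : Continuous (formMatrix : (En n →L[ℝ] En n) → Sym n) := by
  unfold formMatrix
  refine continuous_matrix fun i j => ?_
  simp only [Matrix.of_apply]
  fun_prop

theorem continuous_vouter_self : Continuous fun P : En n => vouter P P := by
  unfold vouter
  refine continuous_matrix fun i j => ?_
  simp only [Matrix.of_apply]
  fun_prop

theorem inner_eq_sum_formMatrix (X : En n →L[ℝ] En n) (h : En n) :
    inner ℝ (X h) h = ∑ i, ∑ j, h i * h j * formMatrix X i j := by
  have e : h = ∑ i, h i • EuclideanSpace.single i (1:ℝ) := by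
    ext k
    simp [Finset.sum_apply, Pi.single_apply]
  conv_lhs => rw [e]
  rw [map_sum]
  simp only [map_smul, sum_inner, inner_sum, real_inner_smul_left,
    real_inner_smul_right, formMatrix, Matrix.of_apply, mul_assoc]
  rw [Finset.sum_comm]
  exact Finset.sum_congr rfl fun i _ => Finset.sum_congr rfl fun j _ => by ring

/-- The form matrix reflects the order of quadratic forms. -/
theorem loewnerLE_formMatrix_neg {X Y : En n →L[ℝ] En n}
    (hX : ∀ h k, inner ℝ (X h) k = inner ℝ (X k) h)
    (hY : ∀ h k, inner ℝ (Y h) k = inner ℝ (Y k) h)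
    (hXY : ∀ h, inner ℝ (X h) h + inner ℝ (Y h) h ≤ 0) (M : Sym n) :
    LoewnerLE (formMatrix X + M) (-formMatrix Y + M) := by
  rw [LoewnerLE, add_sub_add_right_eq_sub]
  refine Matrix.PosSemidef.of_dotProduct_mulVec_nonneg ?_ fun h => ?_
  · ext i j
    simp only [Matrix.conjTranspose_apply, Matrix.sub_apply, Matrix.neg_apply, formMatrix,
      Matrix.of_apply, star_trivial]
    rw [hX, hY]
  · have h1 := hXY (WithLp.toLp 2 h)
    rw [inner_eq_sum_formMatrix, inner_eq_sum_formMatrix] at h1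
    have e : star h ⬝ᵥ (-formMatrix Y - formMatrix X).mulVec h =
        -(∑ i, ∑ j, h i * h j * formMatrix X i j + ∑ i, ∑ j, h i * h j * formMatrix Y i j) := by
      simp only [dotProduct, Matrix.mulVec, Finset.mul_sum, ← Finset.sum_add_distrib,
        ← Finset.sum_neg_distrib, Matrix.sub_apply, Matrix.neg_apply, Pi.star_apply, star_trivial]
      refine Finset.sum_congr rfl fun i _ => Finset.sum_congr rfl fun j _ => ?_
      ring
    rw [e]
    exact neg_nonneg.2 h1

theorem CondB.map_smul_smul {H : En n → Sym n → ℝ} {k₁ : ℝ} (hB : CondB H k₁) {C : ℝ}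
    (hC : 0 < C) (P : En n) (M : Sym n) : H (C • P) (C • M) = C ^ (k₁ + 1) * H P M := by
  rw [hB.2.1, hB.2.2 C hC, abs_of_pos hC, Real.rpow_add hC, Real.rpow_one, mul_assoc]

/-- Evaluation of the operator on logarithmic test functions, perturbed by `t`, as `t → 0`. -/
theorem tendsto_perturbed {H : En n → Sym n → ℝ} (hA : CondA H) (P : En n)
    (X : En n →L[ℝ] En n) (s : ℝ) :
    Tendsto (fun t : ℝ => H P (formMatrix (shift X (s * t)) +
      vouter P P)) (𝓝[>] 0) (𝓝 (H P (formMatrix X + vouter P P))) := by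
  have hc : Continuous fun t : ℝ =>
      H P (formMatrix (shift X (s * t)) + vouter P P) :=
    hA.1.comp (continuous_const.prodMk
      ((continuous_formMatrix.comp
      ((continuous_shift X).comp (continuous_const_mul s))).add continuous_const))
  have := (hc.tendsto 0).mono_left (nhdsWithin_le_nhds (s := Ioi 0))
  rwa [mul_zero, shift_zero] at this

theorem EllSub.le_of_upperJet_log {H : En n → Sym n → ℝ} {k₁ : ℝ} (hA : CondA H)
    (hB : CondB H k₁) {Ω : Set (En n)} {u f : En n → ℝ}
    (hu : ∀ x ∈ closure Ω, 0 < u x) (hsub : EllSub H Ω u f) {ξ P : En n} (hξ : ξ ∈ Ω)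
    {X : En n →L[ℝ] En n} (hX : ∀ h k, inner ℝ (X h) k = inner ℝ (X k) h)
    (hJ : UpperJet (fun x => Real.log (u x)) (closure Ω) ξ P X) :
    f ξ ≤ u ξ ^ (k₁ + 1) * H P (formMatrix X + vouter P P) := by
  have hC := hu ξ (subset_closure hξ)
  refine ge_of_tendsto ((tendsto_perturbed hA P X 2).const_mul _)
    (eventually_nhdsWithin_of_forall fun γ (hγ : 0 < γ) => ?_)
  obtain ⟨r, hr, hJ⟩ := hJ γ hγ
  have hX' := symm_shift hX (2 * γ)
  have h := hsub _ (contDiff_expTest 0 (u ξ) ξ P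
    (shift X (2 * γ))) ξ hξ ?_
  · rwa [gradient_expTest _ _ _ _ hX', ehess_expTest _ _ _ _ hX', hB.map_smul_smul hC] at h
  · filter_upwards [self_mem_nhdsWithin, mem_nhdsWithin_of_mem_nhds (ball_mem_nhds ξ hr)]
      with x hx hxr
    have h1 := hJ (x - ξ) (by rwa [← dist_eq_norm]) (by simpa using subset_closure hx)
    rw [add_sub_cancel] at h1
    have h2 : u x ≤ expTest 0 (u ξ) ξ P (shift X (2 * γ)) x := by
      have h3 := Real.exp_le_exp.2 h1
      rw [Real.exp_log (hu x (subset_closure hx)), add_assoc, add_assoc, Real.exp_add,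
        Real.exp_log hC] at h3
      refine h3.trans (le_of_eq ?_)
      simp only [expTest, inner_shift, real_inner_self_eq_norm_sq, zero_add]
      congr 2
      ring
    have h4 : expTest 0 (u ξ) ξ P (shift X (2 * γ)) ξ = u ξ := by
      simp [expTest]
    rw [h4]
    linarith

theorem EllSuper.le_of_upperJet_neg_log {H : En n → Sym n → ℝ} {k₁ : ℝ} (hA : CondA H)
    (hB : CondB H k₁) {Ω : Set (En n)} {v f : En n → ℝ} {d : ℝ}
    (hv : ∀ x ∈ closure Ω, 0 < v x - d) (hsuper : EllSuper H Ω v f) {ζ P : En n} (hζ : ζ ∈ Ω)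
    {Y : En n →L[ℝ] En n} (hY : ∀ h k, inner ℝ (Y h) k = inner ℝ (Y k) h)
    (hJ : UpperJet (fun x => -Real.log (v x - d)) (closure Ω) ζ P Y) :
    (v ζ - d) ^ (k₁ + 1) * H (-P) (-formMatrix Y + vouter P P) ≤ f ζ := by
  have hC := hv ζ (subset_closure hζ)
  have hY₀ : ∀ h k, inner ℝ ((-Y) h) k = inner ℝ ((-Y) k) h := fun h k => by simp [hY h k]
  have hlim := tendsto_perturbed hA (-P) (-Y) (-2)
  rw [formMatrix_neg, vouter_neg_neg] at hlim
  refine le_of_tendsto (hlim.const_mul _)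
    (eventually_nhdsWithin_of_forall fun γ (hγ : 0 < γ) => ?_)
  obtain ⟨r, hr, hJ⟩ := hJ γ hγ
  have hY' := symm_shift hY₀ (-2 * γ)
  have h := hsuper _ (contDiff_expTest d (v ζ - d) ζ (-P)
    (shift (-Y) (-2 * γ))) ζ hζ ?_
  · rwa [gradient_expTest _ _ _ _ hY', ehess_expTest _ _ _ _ hY', hB.map_smul_smul hC,
      vouter_neg_neg] at h
  · filter_upwards [self_mem_nhdsWithin, mem_nhdsWithin_of_mem_nhds (ball_mem_nhds ζ hr)]
      with x hx hxr
    have h1 := hJ (x - ζ) (by rwa [← dist_eq_norm]) (by simpa using subset_closure hx)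
    rw [add_sub_cancel] at h1
    have h2 : expTest d (v ζ - d) ζ (-P)
        (shift (-Y) (-2 * γ)) x ≤ v x := by
      have h3 : Real.log (v ζ - d) + (-inner ℝ P (x - ζ) - 1 / 2 * inner ℝ (Y (x - ζ)) (x - ζ) -
          γ * ‖x - ζ‖ ^ 2) ≤ Real.log (v x - d) := by linarith
      have h3 := Real.exp_le_exp.2 h3
      rw [Real.exp_log (hv x (subset_closure hx)), Real.exp_add, Real.exp_log hC] at h3
      refine (le_of_eq ?_).trans (add_le_of_le_sub_left h3)
      simp only [expTest, inner_shift, neg_apply, inner_neg_left,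
        real_inner_self_eq_norm_sq]
      congr 2
      ring_nf
    have h4 : expTest d (v ζ - d) ζ (-P)
        (shift (-Y) (-2 * γ)) ζ = v ζ := by
      simp [expTest]
    rw [h4]
    linarith

end Comparison

/-- elliptic quotient comparison principle for the eigenvalue-type
inequalities H(Du,D²u) + λu^k ≥ 0 and H(Dv,D²v) + λv^k ≤ 0. -/
theorem elliptic_quotient_comparison
    {n : ℕ} (hn : 2 ≤ n)
    (H : En n → Sym n → ℝ) (k₁ k : ℝ) (hk : k = k₁ + 1)
    (hA : CondA H) (hB : CondB H k₁)
    (Ω : Set (En n)) (hΩo : IsOpen Ω) (hΩc : IsConnected Ω)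
    (hΩb : Bornology.IsBounded Ω)
    (lam : ℝ) (hlam : 0 < lam)
    (u v : En n → ℝ)
    (husc : UpperSemicontinuousOn u (closure Ω))
    (hupos : ∀ x ∈ closure Ω, 0 < u x)
    (hlsc : LowerSemicontinuousOn v (closure Ω))
    (hvpos : ∀ x ∈ closure Ω, 0 < v x)
    (hsub : EllSub H Ω u (fun y => -(lam * u y ^ k)))
    (hsuper : EllSuper H Ω v (fun y => -(lam * v y ^ k)))  :
    ∀ x ∈ Ω, u x / v x ≤ sSup ((fun y => u y / v y) '' frontier Ω) := by
  intro x₀ hx₀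
  by_contra! hlt
  have hK : IsCompact (closure Ω) := hΩb.isCompact_closure
  have hne : (closure Ω).Nonempty := ⟨x₀, subset_closure hx₀⟩
  have hx₀' := subset_closure hx₀
  obtain ⟨m₁, hm₁, hmax⟩ := husc.exists_isMaxOn hne hK
  obtain ⟨m₂, hm₂, hmin⟩ := hlsc.exists_isMinOn hne hK
  have hbdd : BddAbove ((fun y => u y / v y) '' frontier Ω) := by
    refine ⟨u m₁ / v m₂, ?_⟩
    rintro _ ⟨y, hy, rfl⟩
    have hy' := frontier_subset_closure hy
    exact div_le_div₀ (hupos _ hm₁).le (hmax hy') (hvpos _ hm₂) (hmin hy')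
  set ρ := u x₀ / v x₀ with hρ
  have hρ0 : 0 < ρ := div_pos (hupos _ hx₀') (hvpos _ hx₀')
  obtain ⟨S, hS0, hSρ, hS⟩ : ∃ S, 0 < S ∧ S < ρ ∧ ∀ y ∈ frontier Ω, u y ≤ S * v y :=
    ⟨max (sSup ((fun y => u y / v y) '' frontier Ω)) (ρ / 2), lt_max_of_lt_right (by positivity),
      max_lt hlt (by linarith), fun y hy => by
        rw [← div_le_iff₀ (hvpos y (frontier_subset_closure hy))]
        exact (le_csSup hbdd (mem_image_of_mem _ hy)).trans (le_max_left _ _)⟩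
  set m := v m₂ with hm
  have hm0 : 0 < m := hvpos _ hm₂
  have hvm : ∀ x ∈ closure Ω, m ≤ v x := fun x hx => hmin hx
  -- shift `v` by a small constant, keeping the strict inequality at `x₀`
  obtain ⟨d, hdρ, hd0, hdm⟩ : ∃ d, S * m / (m - d) < ρ ∧ 0 < d ∧ d < m := by
    have hc : ContinuousAt (fun d => S * m / (m - d)) 0 :=
      ContinuousAt.div (by fun_prop) (by fun_prop) (by simpa using hm0.ne')
    have h1 : ∀ᶠ d in nhds (0 : ℝ), S * m / (m - d) < ρ :=
      hc.eventually_lt continuousAt_const (by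
        rw [sub_zero, mul_div_assoc, div_self hm0.ne', mul_one]; exact hSρ)
    obtain ⟨d, h, hd⟩ := ((h1.filter_mono nhdsWithin_le_nhds).and
      (Ioo_mem_nhdsGT hm0)).exists
    exact ⟨d, h, hd.1, hd.2⟩
  have hvd : ∀ x ∈ closure Ω, 0 < v x - d := fun x hx => by linarith [hvm x hx]
  set τ := S * m / (m - d) with hτ
  have hτ0 : 0 < τ := div_pos (by positivity) (by linarith)
  have hτm : τ * (m - d) = S * m := div_mul_cancel₀ _ (by linarith)
  set a₁ : En n → ℝ := fun x => Real.log (u x) with ha₁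
  set a₂ : En n → ℝ := fun x => -Real.log (v x - d) with ha₂
  have h₁ : UpperSemicontinuousOn a₁ (closure Ω) := fun x hx y hy => by
    filter_upwards [husc x hx (Real.exp y) ((Real.log_lt_iff_lt_exp (hupos x hx)).1 hy),
      self_mem_nhdsWithin] with z hz hzK
    exact (Real.log_lt_iff_lt_exp (hupos z hzK)).2 hz
  have h₂ : UpperSemicontinuousOn a₂ (closure Ω) := fun x hx y hy => by
    have h : Real.exp (-y) < v x - d :=
      (Real.lt_log_iff_exp_lt (hvd x hx)).1 (by simp only [ha₂] at hy; linarith)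
    filter_upwards [hlsc x hx (Real.exp (-y) + d) (by linarith), self_mem_nhdsWithin]
      with z hz hzK
    have := (Real.lt_log_iff_exp_lt (hvd z hzK)).2 (by linarith)
    simp only [ha₂]
    linarith
  set κ := (a₁ x₀ + a₂ x₀ - Real.log τ) / 2 with hκ
  have hκ0 : 0 < κ := by
    have h : τ * (v x₀ - d) < u x₀ := by
      have h1 : τ * v x₀ < u x₀ := (lt_div_iff₀ (hvpos _ hx₀')).1 hdρ
      nlinarith
    have h2 := Real.log_lt_log (mul_pos hτ0 (hvd _ hx₀')) h
    rw [Real.log_mul hτ0.ne' (hvd _ hx₀').ne'] at h2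
    simp only [hκ, ha₁, ha₂]
    linarith
  have hbd : ∀ y ∈ frontier Ω, a₁ y + a₂ y < a₁ x₀ + a₂ x₀ - κ := fun y hy => by
    have hy' := frontier_subset_closure hy
    have h : u y ≤ τ * (v y - d) := by
      refine (hS y hy).trans ?_
      have h1 := hvm y hy'
      have h2 : S ≤ τ := by
        refine le_of_mul_le_mul_right ?_ hm0
        nlinarith
      nlinarith
    have h2 := Real.log_le_log (hupos y hy') h
    rw [Real.log_mul hτ0.ne' (hvd _ hy').ne'] at h2
    have h3 : a₁ y + a₂ y ≤ Real.log τ := by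
      simp only [ha₁, ha₂]
      linarith
    linarith
  obtain ⟨ξ, ζ, P, Q, X, Y, P₀, X₀, Y₀, hj, lP, lQ, lX, lY⟩ :=
    exists_tendsto_opposed_upperJets hΩo hΩb h₁ h₂ hx₀ hκ0 hbd
  have sub : ∀ j, -lam ≤ H (P j) (formMatrix (X j) + vouter (P j) (P j)) := fun j => by
    obtain ⟨hξ, -, -, jX, -, hX, -⟩ := hj j
    have h := hsub.le_of_upperJet_log hA hB hupos hξ hX jX
    have hp : 0 < u (ξ j) ^ k := Real.rpow_pos_of_pos (hupos _ (subset_closure hξ)) _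
    rw [← hk] at h
    exact le_of_mul_le_mul_left (by linarith) hp
  set V := Real.exp (a₁ m₁ - (a₁ x₀ + a₂ x₀ - κ)) with hV
  have hV0 : 0 < V := Real.exp_pos _
  have hk0 : 0 < k := by linarith [hB.1]
  have super : ∀ j, H (-Q j) (-formMatrix (Y j) + vouter (Q j) (Q j)) ≤ -(lam * (1 + d / V) ^ k) :=
    fun j => by
    obtain ⟨hξ, hζ, hs, -, jY, -, hY, -⟩ := hj j
    have h := hsuper.le_of_upperJet_neg_log hA hB hvd hζ hY jY
    have hc := hvd _ (subset_closure hζ)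
    have hp : 0 < (v (ζ j) - d) ^ k := Real.rpow_pos_of_pos hc _
    have hle : v (ζ j) - d ≤ V := by
      rw [hV, ← Real.log_le_iff_le_exp hc]
      have h1 : a₁ (ξ j) ≤ a₁ m₁ := Real.log_le_log (hupos _ (subset_closure hξ))
        (hmax (subset_closure hξ))
      have h2 : a₂ (ζ j) = -Real.log (v (ζ j) - d) := rfl
      linarith
    have h3 : (v (ζ j) - d) * (1 + d / V) ≤ v (ζ j) := by
      have : (v (ζ j) - d) * (d / V) ≤ d := by
        rw [← mul_div_assoc, div_le_iff₀ hV0, mul_comm]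
        exact mul_le_mul_of_nonneg_left hle hd0.le
      linarith
    have h4 : (v (ζ j) - d) ^ k * (1 + d / V) ^ k ≤ v (ζ j) ^ k := by
      rw [← Real.mul_rpow hc.le (by positivity)]
      exact Real.rpow_le_rpow (by positivity) h3 hk0.le
    rw [← hk] at h
    refine le_of_mul_le_mul_left (h.trans ?_) hp
    have := mul_le_mul_of_nonneg_left h4 hlam.le
    linarith
  have hcont : Continuous fun q : En n × (En n →L[ℝ] En n) =>
      H q.1 (formMatrix q.2 + vouter q.1 q.1) :=
    hA.1.comp (continuous_fst.prodMk ((continuous_formMatrix.comp continuous_snd).add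
      (continuous_vouter_self.comp continuous_fst)))
  have subLim : -lam ≤ H P₀ (formMatrix X₀ + vouter P₀ P₀) :=
    ge_of_tendsto' ((hcont.tendsto (P₀, X₀)).comp (lP.prodMk_nhds lX)) sub
  have superLim : H P₀ (-formMatrix Y₀ + vouter P₀ P₀) ≤ -(lam * (1 + d / V) ^ k) := by
    have hl := (hcont.tendsto (P₀, -Y₀)).comp
      ((by simpa using lQ.neg : Tendsto (fun j => -Q j) atTop (nhds P₀)).prodMk_nhds lY.neg)
    simp only [formMatrix_neg] at hl
    refine le_of_tendsto' hl fun j => ?_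
    simpa only [Function.comp_apply, formMatrix_neg, vouter_neg_neg] using super j
  have aX : ∀ h, Tendsto (fun j => X j h) atTop (nhds (X₀ h)) := fun h =>
    ((ContinuousLinearMap.apply ℝ (En n) h).continuous.tendsto X₀).comp lX
  have aY : ∀ h, Tendsto (fun j => Y j h) atTop (nhds (Y₀ h)) := fun h =>
    ((ContinuousLinearMap.apply ℝ (En n) h).continuous.tendsto Y₀).comp lY
  have hX₀ : ∀ h k, inner ℝ (X₀ h) k = inner ℝ (X₀ k) h := fun h k =>
    tendsto_nhds_unique ((aX h).inner tendsto_const_nhds)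
      (by simpa only [(hj _).2.2.2.2.2.1 h k] using (aX k).inner tendsto_const_nhds)
  have hY₀ : ∀ h k, inner ℝ (Y₀ h) k = inner ℝ (Y₀ k) h := fun h k =>
    tendsto_nhds_unique ((aY h).inner tendsto_const_nhds)
      (by simpa only [(hj _).2.2.2.2.2.2.1 h k] using (aY k).inner tendsto_const_nhds)
  have hXY : ∀ h, inner ℝ (X₀ h) h + inner ℝ (Y₀ h) h ≤ 0 := fun h =>
    le_of_tendsto' (((aX h).inner tendsto_const_nhds).add ((aY h).inner tendsto_const_nhds))
      fun j => (hj j).2.2.2.2.2.2.2 h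
  have hmono := hA.2.2 P₀ _ _ (loewnerLE_formMatrix_neg hX₀ hY₀ hXY (vouter P₀ P₀))
  have h1 : 1 < (1 + d / V) ^ k :=
    Real.one_lt_rpow (by linarith [show 0 < d / V by positivity]) hk0
  have h2 : lam * 1 < lam * (1 + d / V) ^ k := mul_lt_mul_of_pos_left h1 hlam
  linarith

end DNLP
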